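/- arXiv:1611.10068 — 4 statements merged into one kernel-verified Lean document; each statement's English description precedes it below -/
import Mathlib

section
/- For every odd n ≥ 3 there exists a stateless protocol on the bidirectional n-ring with label space Σ = {0,1}² (reaction functions ignore inputs and outputs, and each node sends the same label on both of its outgoing edges) that implements a 2-counter: under the synchronous schedule, for every initial labeling there is a time T such that for all t ≥ T the second bit of every edge label at time t equals a common bit b_t, and b_{t+1} = 1 − b_t for all t ≥ T. -/
/-- A stateless protocol on the directed graph with node set `Fin n` and edge set
`E`, with label space `Λ`.  `react i` maps the current labeling (of which only
the values on `i`'s incoming edges may be used, per `react_local`) together with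
`i`'s input bit to a new labeling (of which only the values on `i`'s outgoing
edges are ever read) together with an output bit. -/
structure StatelessProtocol (n : ℕ) (E : Finset (Fin n × Fin n)) (Λ : Type) where
  react : Fin n → ({e // e ∈ E} → Λ) → Bool → ({e // e ∈ E} → Λ) × Bool
  react_local : ∀ (i : Fin n) (ℓ ℓ' : {e // e ∈ E} → Λ) (x : Bool),
      (∀ e : {e // e ∈ E}, e.1.2 = i → ℓ e = ℓ' e) → react i ℓ x = react i ℓ' x

namespace StatelessProtocol

variable {n : ℕ} {E : Finset (Fin n × Fin n)} {Λ : Type}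

/-- `run P x σ ℓ0 t` is the labeling after `t` time steps of the run of `P` on
input `x` from initial labeling `ℓ0`, where `σ t` is the set of nodes activated
at time step `t + 1`. -/
def run (P : StatelessProtocol n E Λ) (x : Fin n → Bool) (σ : ℕ → Finset (Fin n))
    (ℓ0 : {e // e ∈ E} → Λ) : ℕ → {e // e ∈ E} → Λ
  | 0 => ℓ0
  | t + 1 => fun e =>
      if e.1.1 ∈ σ t then (P.react e.1.1 (run P x σ ℓ0 t) (x e.1.1)).1 e
      else run P x σ ℓ0 t e

/-- A schedule is `r`-fair if every node is activated at least once in every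
window of `r` consecutive time steps. -/
def Fair (σ : ℕ → Finset (Fin n)) (r : ℕ) : Prop :=
  ∀ (i : Fin n) (t : ℕ), ∃ s, t ≤ s ∧ s < t + r ∧ i ∈ σ s

/-- A labeling is stable for input `x` if every reaction function is at a fixed
point: each node's prescribed outgoing labels coincide with the current ones. -/
def Stable (P : StatelessProtocol n E Λ) (x : Fin n → Bool)
    (ℓ : {e // e ∈ E} → Λ) : Prop :=
  ∀ e : {e // e ∈ E}, (P.react e.1.1 ℓ (x e.1.1)).1 e = ℓ e

/-- The labeling after `t` steps of the synchronous run (all nodes activated at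
every step). -/
def syncRun (P : StatelessProtocol n E Λ) (x : Fin n → Bool)
    (ℓ0 : {e // e ∈ E} → Λ) : ℕ → {e // e ∈ E} → Λ :=
  P.run x (fun _ => Finset.univ) ℓ0

/-- The outputs at time step `t` of the synchronous run (the value at time `0`
is a dummy value). -/
def syncOut (P : StatelessProtocol n E Λ) (x : Fin n → Bool)
    (ℓ0 : {e // e ∈ E} → Λ) : ℕ → Fin n → Bool
  | 0 => fun _ => false
  | t + 1 => fun i => (P.react i (P.syncRun x ℓ0 t) (x i)).2

/-- Output stabilization under the synchronous schedule. -/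
def OutputStabilizing (P : StatelessProtocol n E Λ) : Prop :=
  ∀ x ℓ0, ∃ T, ∀ t, T ≤ t → P.syncOut x ℓ0 t = P.syncOut x ℓ0 T

/-- Label stabilization under the synchronous schedule. -/
def LabelStabilizing (P : StatelessProtocol n E Λ) : Prop :=
  ∀ x ℓ0, ∃ T, ∀ t, T ≤ t → P.syncRun x ℓ0 t = P.syncRun x ℓ0 T

/-- `P` computes `f` if on every input and from every initial labeling, every
node's output sequence converges to `f x` under the synchronous schedule. -/
def Computes (P : StatelessProtocol n E Λ) (f : (Fin n → Bool) → Bool) : Prop :=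
  ∀ x ℓ0, ∃ T, ∀ t, T ≤ t → ∀ i, P.syncOut x ℓ0 t i = f x

end StatelessProtocol

/-- The complete directed graph on `Fin n`. -/
def Kn (n : ℕ) : Finset (Fin n × Fin n) :=
  Finset.univ.filter (fun p => p.1 ≠ p.2)

/-- The unidirectional `n`-ring: edges `(i, i + 1 mod n)`. -/
def uniRing (n : ℕ) : Finset (Fin n × Fin n) :=
  Finset.image (fun i : Fin n => (i, ⟨((i : ℕ) + 1) % n, Nat.mod_lt _ i.pos⟩)) Finset.univ

/-- The bidirectional `n`-ring: edges `(i, i ± 1 mod n)`. -/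
def biRing (n : ℕ) : Finset (Fin n × Fin n) :=
  uniRing n ∪ (uniRing n).image (fun p => (p.2, p.1))

def tcStep (z : Prop) [Decidable z] (a b : Bool × Bool) : Bool × Bool :=
  if z then (! b.1, xor a.1 b.1) else (a.1, ! a.2)

def tcSucc {n : ℕ} (i : Fin n) : Fin n := ⟨((i : ℕ) + 1) % n, Nat.mod_lt _ i.pos⟩

def tcPred {n : ℕ} (i : Fin n) : Fin n := ⟨((i : ℕ) + (n - 1)) % n, Nat.mod_lt _ i.pos⟩

theorem tcSucc_pred {n : ℕ} (i : Fin n) : tcSucc (tcPred i) = i := by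
  have h := i.pos
  have hi := i.2
  apply Fin.ext
  simp only [tcSucc, tcPred, Nat.mod_add_mod]
  rw [show (i : ℕ) + (n - 1) + 1 = i + n by omega, Nat.add_mod_right, Nat.mod_eq_of_lt hi]

theorem tc_mem_succ {n : ℕ} (i : Fin n) : (i, tcSucc i) ∈ uniRing n :=
  Finset.mem_image.2 ⟨i, Finset.mem_univ _, rfl⟩

def tcInL {n : ℕ} (i : Fin n) : {e // e ∈ biRing n} :=
  ⟨(tcPred i, i), Finset.mem_union_left _ (by
    have h := tc_mem_succ (tcPred i)
    rwa [tcSucc_pred] at h)⟩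

def tcInR {n : ℕ} (i : Fin n) : {e // e ∈ biRing n} :=
  ⟨(tcSucc i, i), Finset.mem_union_right _
    (Finset.mem_image.2 ⟨(i, tcSucc i), tc_mem_succ i, rfl⟩)⟩

def tcProtocol (n : ℕ) : StatelessProtocol n (biRing n) (Bool × Bool) where
  react i ℓ _ := (fun _ => tcStep ((i : ℕ) = 0) (ℓ (tcInL i)) (ℓ (tcInR i)), false)
  react_local i ℓ ℓ' x h := by
    rw [h (tcInL i) rfl, h (tcInR i) rfl]

/-- The abstract recurrence: if node 0 emits the negation of its neighbour and the others forward,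
the second bits eventually agree and alternate. -/
theorem tc_abstract (m : ℕ) (c d : ℕ → ℕ → Bool)
    (hc0 : ∀ t, c (t + 1) 0 = ! c t 1)
    (hck : ∀ t k, k + 1 < 2 * m + 3 → c (t + 1) (k + 1) = c t k)
    (hd0 : ∀ t, d (t + 1) 0 = xor (c t (2 * m + 2)) (c t 1))
    (hdk : ∀ t k, k + 1 < 2 * m + 3 → d (t + 1) (k + 1) = ! d t k) :
    (∀ t, 2 * m + 3 ≤ t → d (t + 1) 0 = ! d t 0) ∧
    (∀ t k, k < 2 * m + 3 → 2 * m + 3 + k ≤ t → d t k = d t 0) := by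
  have h2 : ∀ t, c (t + 2) 0 = ! c t 0 := by
    intro t
    rw [hc0, hck t 0 (by omega)]
  have hfwd : ∀ k t, k < 2 * m + 3 → c (t + k) k = c t 0 := by
    intro k
    induction k with
    | zero => intro t _; rfl
    | succ k ih =>
      intro t hk
      rw [← add_assoc, hck _ _ hk, ih t (by omega)]
  have hrot : ∀ q t, xor (c (t + 2 * q) 0) (c (t + 1 + 2 * q) 0) = xor (c t 0) (c (t + 1) 0) := by
    intro q
    induction q with
    | zero => intro t; rfl
    | succ q ih =>
      intro t
      rw [← ih t, show t + 2 * (q + 1) = t + 2 * q + 2 by ring,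
        show t + 1 + 2 * (q + 1) = t + 1 + 2 * q + 2 by ring, h2, h2]
      cases c (t + 2 * q) 0 <;> cases c (t + 1 + 2 * q) 0 <;> rfl
  have hD : ∀ t, d (t + (2 * m + 3)) 0 = xor (c t 0) (c (t + 1 + 2 * m) 0) := by
    intro t
    rw [show t + (2 * m + 3) = t + (2 * m + 2) + 1 by ring, hd0, hfwd _ _ (by omega),
      show t + (2 * m + 2) = t + 1 + 2 * m + 1 by ring, hck _ 0 (by omega)]
  have halt : ∀ t, 2 * m + 3 ≤ t → d (t + 1) 0 = ! d t 0 := by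
    intro t ht
    obtain ⟨s, rfl⟩ := Nat.exists_eq_add_of_le' ht
    rw [show s + (2 * m + 3) + 1 = s + 1 + (2 * m + 3) by ring, hD, hD]
    have e1 := hrot m s
    have e2 := hrot m (s + 1)
    rw [h2] at e2
    revert e1 e2
    generalize c s 0 = x1
    generalize c (s + 1) 0 = x2
    generalize c (s + 2 * m) 0 = x3
    generalize c (s + 1 + 2 * m) 0 = x4
    generalize c (s + 1 + 1 + 2 * m) 0 = x5
    revert x1 x2 x3 x4 x5
    decide
  refine ⟨halt, ?_⟩
  intro t k
  induction k generalizing t with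
  | zero => intros; rfl
  | succ k ih =>
    intro hk ht
    obtain ⟨s, rfl⟩ := Nat.exists_eq_add_of_le' (show 1 ≤ t by omega)
    rw [hdk _ _ hk, ih s (by omega) (by omega), halt s (by omega)]

open StatelessProtocol in
theorem tc_main (m : ℕ) (x : Fin (2 * m + 3) → Bool)
    (ℓ0 : {e // e ∈ biRing (2 * m + 3)} → Bool × Bool) :
    ∃ (T : ℕ) (b : ℕ → Bool),
      (∀ t, T ≤ t → ∀ e : {e // e ∈ biRing (2 * m + 3)},
        ((tcProtocol (2 * m + 3)).syncRun x ℓ0 t e).2 = b t) ∧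
      (∀ t, T ≤ t → b (t + 1) = ! b t) := by
  set r := (tcProtocol (2 * m + 3)).syncRun x ℓ0 with hr
  let A : ℕ → Fin (2 * m + 3) → Bool × Bool :=
    fun t i => tcStep ((i : ℕ) = 0) (r t (tcInL i)) (r t (tcInR i))
  have hrun : ∀ t e, r (t + 1) e = A t e.1.1 := by
    intro t e
    simp only [hr, syncRun, run, Finset.mem_univ, if_true]
    rfl
  have hA : ∀ t i, A (t + 1) i = tcStep ((i : ℕ) = 0) (A t (tcPred i)) (A t (tcSucc i)) := by
    intro t i
    change tcStep _ (r (t + 1) _) (r (t + 1) _) = _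
    rw [hrun, hrun]
    rfl
  let B : ℕ → ℕ → Bool × Bool := fun t k => A t (Fin.ofNat (2 * m + 3) k)
  have hB0 : ∀ t, B (t + 1) 0 = (! (B t 1).1, xor (B t (2 * m + 2)).1 (B t 1).1) := by
    intro t
    change A (t + 1) _ = _
    rw [hA]
    have e1 : tcPred (Fin.ofNat (2 * m + 3) 0) = Fin.ofNat (2 * m + 3) (2 * m + 2) := by
      apply Fin.ext; simp [tcPred, Fin.ofNat]
    have e2 : tcSucc (Fin.ofNat (2 * m + 3) 0) = Fin.ofNat (2 * m + 3) 1 := by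
      apply Fin.ext; simp [tcSucc, Fin.ofNat]
    rw [e1, e2]
    simp [tcStep, B]
  have hBk : ∀ t k, k + 1 < 2 * m + 3 → B (t + 1) (k + 1) = ((B t k).1, ! (B t k).2) := by
    intro t k hk
    change A (t + 1) _ = _
    rw [hA]
    have e1 : tcPred (Fin.ofNat (2 * m + 3) (k + 1)) = Fin.ofNat (2 * m + 3) k := by
      apply Fin.ext
      simp only [tcPred, Fin.ofNat, Nat.mod_add_mod]
      rw [show k + 1 + (2 * m + 3 - 1) = k + (2 * m + 3) by omega, Nat.add_mod_right]
    have e3 : ¬ ((Fin.ofNat (2 * m + 3) (k + 1) : Fin (2 * m + 3)) : ℕ) = 0 := by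
      simp only [Fin.ofNat]
      rw [Nat.mod_eq_of_lt hk]
      omega
    rw [e1, tcStep, if_neg e3]
  obtain ⟨h1, h2⟩ := tc_abstract m (fun t k => (B t k).1) (fun t k => (B t k).2)
    (fun t => by simp only [hB0]) (fun t k hk => by simp only [hBk t k hk])
    (fun t => by simp only [hB0]) (fun t k hk => by simp only [hBk t k hk])
  refine ⟨4 * m + 7, fun t => (B (t - 1) 0).2, ?_, ?_⟩
  · intro t ht e
    obtain ⟨s, rfl⟩ := Nat.exists_eq_add_of_le' (show 1 ≤ t by omega)
    have hlt := e.1.1.2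
    have := h2 s e.1.1 hlt (by omega)
    rw [hrun]
    change _ = (B s 0).2
    rw [← this]
    have e4 : Fin.ofNat (2 * m + 3) (e.1.1 : ℕ) = e.1.1 := by
      apply Fin.ext
      simp only [Fin.ofNat]
      exact Nat.mod_eq_of_lt hlt
    simp only [B, e4]
  · intro t ht
    obtain ⟨s, rfl⟩ := Nat.exists_eq_add_of_le' (show 1 ≤ t by omega)
    exact h1 s (by omega)

open StatelessProtocol in
/-- For every odd `n ≥ 3` there is a stateless protocol on the
bidirectional `n`-ring with label space `{0,1}²` — whose reaction functions
ignore the inputs and send the same label on both outgoing edges — implementing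
a 2-counter: under the synchronous schedule, from every initial labeling,
eventually the second bit of every edge label equals a common bit that
alternates at each step. -/
theorem exists_two_counter (n : ℕ) (hn : 3 ≤ n) (hodd : Odd n) :
    ∃ P : StatelessProtocol n (biRing n) (Bool × Bool),
      (∀ i ℓ x x', P.react i ℓ x = P.react i ℓ x') ∧
      (∀ i ℓ x, ∀ e e' : {e // e ∈ biRing n}, e.1.1 = i → e'.1.1 = i →
        (P.react i ℓ x).1 e = (P.react i ℓ x).1 e') ∧
      ∀ (x : Fin n → Bool) (ℓ0 : {e // e ∈ biRing n} → Bool × Bool),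
        ∃ (T : ℕ) (b : ℕ → Bool),
          (∀ t, T ≤ t → ∀ e : {e // e ∈ biRing n}, (P.syncRun x ℓ0 t e).2 = b t) ∧
          (∀ t, T ≤ t → b (t + 1) = ! b t) := by
  refine ⟨tcProtocol n, fun _ _ _ _ => rfl, fun _ _ _ _ _ _ _ => rfl, ?_⟩
  obtain ⟨m, rfl⟩ : ∃ m, n = 2 * m + 3 := by
    obtain ⟨k, hk⟩ := hodd
    exact ⟨k - 1, by omega⟩
  exact tc_main m
end

section
/- Let m ≤ n, let f : {0,1}^n → {0,1}, and let G = ([n], E) be a directed graph. Define C = {(i,j) ∈ E : i ≤ m < j} and D = {(i,j) ∈ E : j ≤ m < i}. Suppose f has a fooling set S ⊆ {0,1}^m × {0,1}^{n−m} (with value b) such that for every (x,y), (x′,y′) ∈ S: if (i,j) ∈ C then x_i = x′_i, and if (i,j) ∈ D then y_i = y′_i (where y is indexed by coordinates m+1,…,n). Then every label-stabilizing stateless protocol on G that computes f has label complexity L_n = log₂|Σ| ≥ log₂(|S|)/(|C| + |D|). -/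
/-- Glue an assignment on the first `m` coordinates and one on the remaining
`n - m` coordinates into an assignment on all `n` coordinates. -/
def glue {n m : ℕ} (x : Fin m → Bool) (y : Fin (n - m) → Bool) : Fin n → Bool :=
  fun i => if h : (i : ℕ) < m then x ⟨i, h⟩
    else y ⟨(i : ℕ) - m, by have := i.isLt; omega⟩

namespace StatelessProtocol

/-- From label stabilization and correctness: a stable labeling with correct outputs. -/
lemma exists_stable_aux {n : ℕ} {E : Finset (Fin n × Fin n)} {Λ : Type} [Nonempty Λ]
    (P : StatelessProtocol n E Λ) (f : (Fin n → Bool) → Bool)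
    (hls : P.LabelStabilizing) (hcomp : P.Computes f) (x : Fin n → Bool) :
    ∃ ℓ, P.Stable x ℓ ∧ ∀ i, (P.react i ℓ (x i)).2 = f x := by
  obtain ⟨T, hT⟩ := hls x (fun _ => Classical.arbitrary Λ)
  obtain ⟨U, hU⟩ := hcomp x (fun _ => Classical.arbitrary Λ)
  refine ⟨P.syncRun x (fun _ => Classical.arbitrary Λ) T, ?_, ?_⟩
  · intro e
    have h := congrFun (hT (T + 1) (by omega)) e
    rw [← h]
    simp [syncRun, run]
  · intro i
    have h := hU (max T U + 1) (by omega) i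
    simp only [syncOut] at h
    rwa [hT (max T U) (by omega)] at h

/-- A stable labeling is fixed by the synchronous run. -/
lemma syncRun_of_stable {n : ℕ} {E : Finset (Fin n × Fin n)} {Λ : Type}
    (P : StatelessProtocol n E Λ) (x : Fin n → Bool) (ℓ : {e // e ∈ E} → Λ)
    (h : P.Stable x ℓ) (t : ℕ) : P.syncRun x ℓ t = ℓ := by
  induction t with
  | zero => rfl
  | succ t ih =>
    funext e
    have : P.syncRun x ℓ (t + 1) e = (P.react e.1.1 (P.syncRun x ℓ t) (x e.1.1)).1 e := by
      simp [syncRun, run]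
    rw [this, ih]
    exact h e

/-- Mixing two stable labelings which agree on all crossing edges. -/
lemma mix_aux {n m : ℕ} {E : Finset (Fin n × Fin n)} {Λ : Type}
    (P : StatelessProtocol n E Λ) (f : (Fin n → Bool) → Bool) (hcomp : P.Computes f)
    (hn : 0 < n) (b : Bool)
    (p q : (Fin m → Bool) × (Fin (n - m) → Bool)) (k l : {e // e ∈ E} → Λ)
    (hk : P.Stable (glue p.1 p.2) k) (hl : P.Stable (glue q.1 q.2) l)
    (hkb : ∀ i, (P.react i k (glue p.1 p.2 i)).2 = b)
    (hlb : ∀ i, (P.react i l (glue q.1 q.2 i)).2 = b)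
    (hC : ∀ e : {e // e ∈ E}, e.1.1.1 < m → m ≤ e.1.2.1 → k e = l e)
    (hD : ∀ e : {e // e ∈ E}, e.1.2.1 < m → m ≤ e.1.1.1 → k e = l e) :
    f (glue p.1 q.2) = b := by
  set w : {e // e ∈ E} → Λ := fun e => if e.1.1.1 < m then k e else l e with hw
  have h1 : ∀ i : Fin n, i.1 < m →
      P.react i w (glue p.1 q.2 i) = P.react i k (glue p.1 p.2 i) := by
    intro i hi
    have hg : (glue p.1 q.2 : Fin n → Bool) i = glue p.1 p.2 i := by simp [glue, hi]
    rw [hg]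
    apply P.react_local
    intro e he
    simp only [hw]
    split_ifs with h
    · rfl
    · exact (hD e (by rw [he]; exact hi) (by omega)).symm
  have h2 : ∀ i : Fin n, ¬ i.1 < m →
      P.react i w (glue p.1 q.2 i) = P.react i l (glue q.1 q.2 i) := by
    intro i hi
    have hg : (glue p.1 q.2 : Fin n → Bool) i = glue q.1 q.2 i := by simp [glue, hi]
    rw [hg]
    apply P.react_local
    intro e he
    simp only [hw]
    split_ifs with h
    · exact hC e h (by rw [he]; omega)
    · rfl
  have hst : P.Stable (glue p.1 q.2) w := by
    intro e
    by_cases h : e.1.1.1 < m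
    · rw [h1 _ h, hk e]; simp [hw, h]
    · rw [h2 _ h, hl e]; simp [hw, h]
  obtain ⟨T, hT⟩ := hcomp (glue p.1 q.2) w
  have h := hT (T + 1) (by omega) ⟨0, hn⟩
  simp only [syncOut] at h
  rw [syncRun_of_stable P _ _ hst] at h
  rw [← h]
  by_cases h0 : (⟨0, hn⟩ : Fin n).1 < m
  · rw [h1 _ h0, hkb]
  · rw [h2 _ h0, hlb]

end StatelessProtocol

open StatelessProtocol in
/-- The fooling-set lower bound on label complexity: if `f` has
a fooling set `S` (with value `b`, split at `m`) whose members agree on all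
coordinates that are sources of edges of `C` (edges leaving `[m]`) and of `D`
(edges entering `[m]`), then every label-stabilizing protocol computing `f` has
label complexity `log₂|Σ| ≥ log₂|S| / (|C| + |D|)`. -/
theorem fooling_set_label_complexity_lower_bound
    {n m : ℕ} (hm : m ≤ n) (E : Finset (Fin n × Fin n))
    (f : (Fin n → Bool) → Bool)
    (S : Finset ((Fin m → Bool) × (Fin (n - m) → Bool))) (b : Bool)
    (hSb : ∀ p ∈ S, f (glue p.1 p.2) = b)
    (hfool : ∀ p ∈ S, ∀ q ∈ S, p ≠ q →
      f (glue p.1 q.2) ≠ b ∨ f (glue q.1 p.2) ≠ b)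
    (hCagree : ∀ p ∈ S, ∀ q ∈ S, ∀ e ∈ E, ∀ h : (e.1 : Fin n).1 < m,
      m ≤ (e.2 : Fin n).1 → p.1 ⟨(e.1 : Fin n).1, h⟩ = q.1 ⟨(e.1 : Fin n).1, h⟩)
    (hDagree : ∀ p ∈ S, ∀ q ∈ S, ∀ e ∈ E, (e.2 : Fin n).1 < m →
      ∀ h : m ≤ (e.1 : Fin n).1,
      p.2 ⟨(e.1 : Fin n).1 - m, by have := (e.1 : Fin n).isLt; omega⟩ =
      q.2 ⟨(e.1 : Fin n).1 - m, by have := (e.1 : Fin n).isLt; omega⟩)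
    {Λ : Type} [Fintype Λ] [Nonempty Λ]
    (P : StatelessProtocol n E Λ)
    (hls : P.LabelStabilizing) (hcomp : P.Computes f) :
    Real.logb 2 (S.card) /
        (((E.filter (fun e => (e.1 : Fin n).1 < m ∧ m ≤ (e.2 : Fin n).1)).card +
          (E.filter (fun e => (e.2 : Fin n).1 < m ∧ m ≤ (e.1 : Fin n).1)).card : ℕ) : ℝ) ≤
      Real.logb 2 (Fintype.card Λ) := by
  classical
  set C := E.filter (fun e => (e.1 : Fin n).1 < m ∧ m ≤ (e.2 : Fin n).1) with hCdef
  set D := E.filter (fun e => (e.2 : Fin n).1 < m ∧ m ≤ (e.1 : Fin n).1) with hDdef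
  choose L hL hLo using fun x => P.exists_stable_aux f hls hcomp x
  have hΛ : 1 ≤ Fintype.card Λ := Fintype.card_pos
  have hcard : S.card ≤ Fintype.card Λ ^ (C.card + D.card) := by
    let g : (Fin m → Bool) × (Fin (n - m) → Bool) → ({e // e ∈ C} → Λ) × ({e // e ∈ D} → Λ) :=
      fun p => (fun e => L (glue p.1 p.2) ⟨e.1, (Finset.mem_filter.1 e.2).1⟩,
        fun e => L (glue p.1 p.2) ⟨e.1, (Finset.mem_filter.1 e.2).1⟩)
    have hinj : Set.InjOn g (S : Set _) := by
      intro p hp q hq hpq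
      by_contra hne
      have hn : 0 < n := by
        rcases Nat.eq_zero_or_pos n with h | h
        · exfalso
          subst h
          obtain rfl : m = 0 := by omega
          exact hne (Subsingleton.elim (α := (Fin 0 → Bool) × (Fin 0 → Bool)) p q)
        · exact h
      have hp' : p ∈ S := hp
      have hq' : q ∈ S := hq
      have hC : ∀ e : {e // e ∈ E}, e.1.1.1 < m → m ≤ e.1.2.1 →
          L (glue p.1 p.2) e = L (glue q.1 q.2) e := fun e h1 h2 =>
        congrFun (congrArg Prod.fst hpq) ⟨e.1, Finset.mem_filter.2 ⟨e.2, h1, h2⟩⟩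
      have hD : ∀ e : {e // e ∈ E}, e.1.2.1 < m → m ≤ e.1.1.1 →
          L (glue p.1 p.2) e = L (glue q.1 q.2) e := fun e h1 h2 =>
        congrFun (congrArg Prod.snd hpq) ⟨e.1, Finset.mem_filter.2 ⟨e.2, h1, h2⟩⟩
      have hpo := fun i => (hLo (glue p.1 p.2) i).trans (hSb p hp')
      have hqo := fun i => (hLo (glue q.1 q.2) i).trans (hSb q hq')
      rcases hfool p hp' q hq' hne with h | h
      · exact h (P.mix_aux f hcomp hn b p q _ _ (hL _) (hL _) hpo hqo hC hD)
      · exact h (P.mix_aux f hcomp hn b q p _ _ (hL _) (hL _) hqo hpo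
          (fun e h1 h2 => (hC e h1 h2).symm) (fun e h1 h2 => (hD e h1 h2).symm))
    have h := Finset.card_le_card_of_injOn (t := Finset.univ) g (fun _ _ => Finset.mem_univ _) hinj
    rw [Finset.card_univ, Fintype.card_prod, Fintype.card_fun, Fintype.card_fun,
      Fintype.card_coe, Fintype.card_coe, ← pow_add] at h
    exact h
  have hlog0 : 0 ≤ Real.logb 2 (Fintype.card Λ) :=
    Real.logb_nonneg (by norm_num) (by exact_mod_cast hΛ)
  apply div_le_of_le_mul₀ (Nat.cast_nonneg _) hlog0
  rcases Nat.eq_zero_or_pos S.card with h0 | h0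
  · rw [h0]
    simp only [Nat.cast_zero, Real.logb_zero]
    positivity
  · rw [mul_comm, ← Real.logb_pow]
    apply Real.logb_le_logb_of_le (by norm_num) (by exact_mod_cast h0)
    exact_mod_cast hcard
end

section
/- Let n ≥ 2 and let Maj_n : {0,1}^n → {0,1} be defined by Maj_n(x) = 1 if and only if x_1 + x_2 + … + x_n ≥ n/2. Then every label-stabilizing stateless protocol on the bidirectional n-ring that computes Maj_n has label complexity L_n = log₂|Σ| ≥ log₂(⌊n/2⌋)/4. -/
/-- The majority function: `1` iff at least half of the input bits are `1`. -/
def majFun (n : ℕ) : (Fin n → Bool) → Bool := fun x =>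
  decide (n ≤ 2 * (Finset.univ.filter (fun i => x i = true)).card)

open StatelessProtocol in
theorem aux_syncRun_stable {n : ℕ} {E : Finset (Fin n × Fin n)} {Λ : Type}
    (P : StatelessProtocol n E Λ) (x : Fin n → Bool) (ℓ : {e // e ∈ E} → Λ)
    (h : P.Stable x ℓ) (t : ℕ) : P.syncRun x ℓ t = ℓ := by
  induction t with
  | zero => rfl
  | succ t ih =>
    funext e
    have h1 : P.syncRun x ℓ (t + 1) e = (P.react e.1.1 (P.syncRun x ℓ t) (x e.1.1)).1 e := by
      simp [syncRun, run]
    rw [h1, ih]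
    exact h e

open StatelessProtocol in
theorem aux_out_stable {n : ℕ} {E : Finset (Fin n × Fin n)} {Λ : Type}
    (P : StatelessProtocol n E Λ) (f : (Fin n → Bool) → Bool) (hc : P.Computes f)
    (x : Fin n → Bool) (ℓ : {e // e ∈ E} → Λ)
    (h : P.Stable x ℓ) (i : Fin n) : (P.react i ℓ (x i)).2 = f x := by
  obtain ⟨T, hT⟩ := hc x ℓ
  have := hT (T + 1) (by omega) i
  simpa [syncOut, aux_syncRun_stable P x ℓ h] using this

open StatelessProtocol in
theorem aux_exists_stable {n : ℕ} {E : Finset (Fin n × Fin n)} {Λ : Type} [Nonempty Λ]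
    (P : StatelessProtocol n E Λ) (hls : P.LabelStabilizing) (x : Fin n → Bool) :
    ∃ ℓ, P.Stable x ℓ := by
  obtain ⟨T, hT⟩ := hls x (fun _ => Classical.arbitrary Λ)
  refine ⟨P.syncRun x (fun _ => Classical.arbitrary Λ) T, fun e => ?_⟩
  have := congrFun (hT (T + 1) (by omega)) e
  refine Eq.trans ?_ this
  simp [syncRun, run]

theorem aux_mem_biRing {n : ℕ} (i j : Fin n) : (i, j) ∈ biRing n ↔
    (j.1 = i.1 + 1 ∨ (i.1 + 1 = n ∧ j.1 = 0)) ∨ (i.1 = j.1 + 1 ∨ (j.1 + 1 = n ∧ i.1 = 0)) := by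
  have key : ∀ i j : Fin n, (i.1 + 1) % n = j.1 ↔ (j.1 = i.1 + 1 ∨ (i.1 + 1 = n ∧ j.1 = 0)) := by
    intro i j
    have := i.2
    have := j.2
    by_cases h : i.1 + 1 = n
    · rw [h, Nat.mod_self]; omega
    · rw [Nat.mod_eq_of_lt (by omega)]; omega
  rw [← key i j, ← key j i]
  simp only [biRing, uniRing, Finset.mem_union, Finset.mem_image, Finset.mem_univ, true_and,
    Prod.mk.injEq, Prod.exists, Fin.ext_iff]
  constructor
  · rintro (⟨a, h1, h2⟩ | ⟨a, b, ⟨c, h1, h2⟩, h3, h4⟩)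
    · left; rw [← h1]; exact h2
    · right; rw [← h4, ← h1, ← h3]; exact h2
  · rintro (h | h)
    · exact Or.inl ⟨i, rfl, h⟩
    · exact Or.inr ⟨j, i, ⟨j, rfl, h⟩, rfl, rfl⟩

/-- Inputs: `k` ones in the first part and `n - m - k'` ones in the second. -/
def auxInput (n m k k' : ℕ) : Fin n → Bool := fun i =>
  if i.1 < m then decide (i.1 < k) else decide (i.1 + k' < n)

theorem aux_card (n m k k' : ℕ) (hm : m ≤ n) (hk : k ≤ m) (hk' : k' ≤ n - m) :
    (Finset.univ.filter (fun i => auxInput n m k k' i = true)).card = k + (n - m - k') := by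
  have h : (Finset.univ.filter (fun i => auxInput n m k k' i = true)).map Fin.valEmbedding
      = Finset.range k ∪ Finset.Ico m (n - k') := by
    ext a
    simp only [Finset.mem_map, Finset.mem_filter, Finset.mem_univ, true_and,
      Fin.valEmbedding_apply, Finset.mem_union, Finset.mem_range, Finset.mem_Ico]
    constructor
    · rintro ⟨i, hi, rfl⟩
      unfold auxInput at hi
      split_ifs at hi <;> simp at hi <;> omega
    · intro h
      refine ⟨⟨a, by omega⟩, ?_, rfl⟩
      unfold auxInput
      split_ifs with h1 <;> simp only [decide_eq_true_eq] at h1 ⊢ <;> omega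
  rw [← Finset.card_map Fin.valEmbedding, h, Finset.card_union_of_disjoint]
  · simp; omega
  · rw [Finset.disjoint_left]
    intro a
    simp
    omega

open StatelessProtocol in
theorem aux_card_bound (n m : ℕ) (hm2 : m = n / 2) (hm : 2 ≤ m)
    {Λ : Type} [Fintype Λ] [Nonempty Λ]
    (P : StatelessProtocol n (biRing n) Λ)
    (hls : P.LabelStabilizing) (hcomp : P.Computes (majFun n)) :
    m ≤ Fintype.card Λ ^ 4 := by
  classical
  choose L hL using fun k : Fin m => aux_exists_stable P hls (auxInput n m k k)
  let e1 : {e // e ∈ biRing n} := ⟨(⟨m - 1, by omega⟩, ⟨m, by omega⟩), by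
    rw [aux_mem_biRing]; simp; omega⟩
  let e2 : {e // e ∈ biRing n} := ⟨(⟨m, by omega⟩, ⟨m - 1, by omega⟩), by
    rw [aux_mem_biRing]; simp; omega⟩
  let e3 : {e // e ∈ biRing n} := ⟨(⟨n - 1, by omega⟩, ⟨0, by omega⟩), by
    rw [aux_mem_biRing]; simp; omega⟩
  let e4 : {e // e ∈ biRing n} := ⟨(⟨0, by omega⟩, ⟨n - 1, by omega⟩), by
    rw [aux_mem_biRing]; simp; omega⟩
  let g : Fin m → Fin 4 → Λ := fun k => ![L k e1, L k e2, L k e3, L k e4]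
  have hlt : ∀ k k' : Fin m, k < k' → g k ≠ g k' := by
    intro k k' hkk hg
    have h1 : L k e1 = L k' e1 := congrFun hg 0
    have h2 : L k e2 = L k' e2 := congrFun hg 1
    have h3 : L k e3 = L k' e3 := congrFun hg 2
    have h4 : L k e4 = L k' e4 := congrFun hg 3
    have hcross : ∀ e : {e // e ∈ biRing n}, ¬ (e.1.1.1 < m ↔ e.1.2.1 < m) →
        L k e = L k' e := by
      rintro ⟨⟨i, j⟩, he⟩ hne
      have he' := (aux_mem_biRing i j).1 he
      have hi := i.2
      have hj := j.2
      simp only at hne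
      have : (⟨(i, j), he⟩ : {e // e ∈ biRing n}) = e1 ∨ (⟨(i, j), he⟩ : {e // e ∈ biRing n}) = e2
          ∨ (⟨(i, j), he⟩ : {e // e ∈ biRing n}) = e3
          ∨ (⟨(i, j), he⟩ : {e // e ∈ biRing n}) = e4 := by
        simp only [e1, e2, e3, e4, Subtype.mk.injEq, Prod.mk.injEq, Fin.ext_iff]
        omega
      rcases this with h | h | h | h <;> rw [h] <;> assumption
    let ℓ : {e // e ∈ biRing n} → Λ := fun e => if e.1.1.1 < m then L k e else L k' e
    have hA : ∀ i : Fin n, i.1 < m → ∀ x, P.react i ℓ x = P.react i (L k) x := by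
      intro i hi x
      apply P.react_local
      intro e he
      by_cases h : e.1.1.1 < m
      · simp [ℓ, h]
      · simp only [ℓ, h, if_false]
        exact (hcross e (by rw [he]; tauto)).symm
    have hB : ∀ i : Fin n, ¬ i.1 < m → ∀ x, P.react i ℓ x = P.react i (L k') x := by
      intro i hi x
      apply P.react_local
      intro e he
      by_cases h : e.1.1.1 < m
      · simp only [ℓ, h, if_true]
        exact hcross e (by rw [he]; tauto)
      · simp [ℓ, h]
    have hst : P.Stable (auxInput n m k k') ℓ := by
      intro e
      by_cases h : e.1.1.1 < m
      · rw [hA _ h]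
        have := hL k e
        simp only [auxInput, h, if_true, ℓ] at this ⊢
        exact this
      · rw [hB _ h]
        have := hL k' e
        simp only [auxInput, h, if_false, ℓ] at this ⊢
        exact this
    have o1 := aux_out_stable P _ hcomp _ _ hst ⟨0, by omega⟩
    have o2 := aux_out_stable P _ hcomp _ _ (hL k) ⟨0, by omega⟩
    rw [hA _ (by simp; omega)] at o1
    have hx : auxInput n m k k' ⟨0, by omega⟩ = auxInput n m k k ⟨0, by omega⟩ := by
      simp [auxInput, show 0 < m by omega]
    rw [hx, o2] at o1
    have hk := k.2
    have hk' := k'.2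
    have hkk' : k.1 < k'.1 := hkk
    simp only [majFun] at o1
    rw [aux_card _ _ _ _ (by omega) (by omega) (by omega),
      aux_card _ _ _ _ (by omega) (by omega) (by omega), decide_eq_decide] at o1
    omega
  have hinj : Function.Injective g := by
    intro k k' h
    rcases lt_trichotomy k k' with h1 | h1 | h1
    · exact absurd h (hlt _ _ h1)
    · exact h1
    · exact absurd h.symm (hlt _ _ h1)
  have := Fintype.card_le_of_injective g hinj
  simpa using this

open StatelessProtocol in
/-- Every label-stabilizing stateless protocol computing the
majority function on the bidirectional `n`-ring (`n ≥ 2`) has label complexity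
`log₂|Σ| ≥ log₂(⌊n/2⌋) / 4`. -/
theorem maj_label_complexity_lower_bound (n : ℕ) (hn : 2 ≤ n)
    {Λ : Type} [Fintype Λ] [Nonempty Λ]
    (P : StatelessProtocol n (biRing n) Λ)
    (hls : P.LabelStabilizing) (hcomp : P.Computes (majFun n)) :
    Real.logb 2 ((n / 2 : ℕ) : ℝ) / 4 ≤ Real.logb 2 (Fintype.card Λ) := by
  rcases Nat.lt_or_ge (n / 2) 2 with h | h
  · have h1 : n / 2 = 1 := by omega
    rw [h1]
    simp only [Nat.cast_one, Real.logb_one, zero_div]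
    exact Real.logb_nonneg (by norm_num) (by exact_mod_cast Fintype.card_pos)
  · have hb := aux_card_bound n (n / 2) rfl h P hls hcomp
    have hb' : ((n / 2 : ℕ) : ℝ) ≤ (Fintype.card Λ : ℝ) ^ 4 := by exact_mod_cast hb
    have h2 := Real.logb_le_logb_of_le (b := 2) (by norm_num)
      (by exact_mod_cast (by omega : 0 < n / 2)) hb'
    rw [Real.logb_pow] at h2
    push_cast at h2
    linarith
end

section
/- Let K_n denote the complete directed graph on n nodes (every ordered pair of distinct nodes is an edge). For every stateful protocol A = (Σ, δ) on K_n there exists a stateless protocol Ā = (Σ ∪ {ω}, δ̄) on K_{3n}, where ω ∉ Σ is a fresh label, such that for every r ≥ 1: A is label r-stabilizing if and only if Ā is label r-stabilizing. -/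
/-- A *stateful* protocol: like a stateless protocol, except that each node's
reaction function may depend both on its incoming labels and on its own current
outgoing labels. -/
structure StatefulProtocol (n : ℕ) (E : Finset (Fin n × Fin n)) (Λ : Type) where
  react : Fin n → ({e // e ∈ E} → Λ) → Bool → ({e // e ∈ E} → Λ) × Bool
  react_local : ∀ (i : Fin n) (ℓ ℓ' : {e // e ∈ E} → Λ) (x : Bool),
      (∀ e : {e // e ∈ E}, e.1.2 = i ∨ e.1.1 = i → ℓ e = ℓ' e) → react i ℓ x = react i ℓ' x

namespace StatefulProtocol

variable {n : ℕ} {E : Finset (Fin n × Fin n)} {Λ : Type}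

/-- The run of a stateful protocol: `σ t` is the set of nodes activated at time
step `t + 1`. -/
def run (P : StatefulProtocol n E Λ) (x : Fin n → Bool) (σ : ℕ → Finset (Fin n))
    (ℓ0 : {e // e ∈ E} → Λ) : ℕ → {e // e ∈ E} → Λ
  | 0 => ℓ0
  | t + 1 => fun e =>
      if e.1.1 ∈ σ t then (P.react e.1.1 (run P x σ ℓ0 t) (x e.1.1)).1 e
      else run P x σ ℓ0 t e

/-- A stateful protocol is label `r`-stabilizing if for every input, initial
labeling and `r`-fair schedule the labeling sequence is eventually constant. -/
def LabelRStabilizing (P : StatefulProtocol n E Λ) (r : ℕ) : Prop :=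
  ∀ (x : Fin n → Bool) (ℓ0 : {e // e ∈ E} → Λ) (σ : ℕ → Finset (Fin n)),
    (∀ t, (σ t).Nonempty) → StatelessProtocol.Fair σ r →
    ∃ T, ∀ t, T ≤ t → P.run x σ ℓ0 t = P.run x σ ℓ0 T

end StatefulProtocol

/-- A stateless protocol is label `r`-stabilizing if for every input, initial
labeling and `r`-fair schedule the labeling sequence is eventually constant. -/
def StatelessProtocol.LabelRStabilizing {n : ℕ} {E : Finset (Fin n × Fin n)}
    {Λ : Type} (P : StatelessProtocol n E Λ) (r : ℕ) : Prop :=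
  ∀ (x : Fin n → Bool) (ℓ0 : {e // e ∈ E} → Λ) (σ : ℕ → Finset (Fin n)),
    (∀ t, (σ t).Nonempty) → StatelessProtocol.Fair σ r →
    ∃ T, ∀ t, T ≤ t → P.run x σ ℓ0 t = P.run x σ ℓ0 T

namespace S2S

/-- one step of a stateful protocol -/
def stepA {n : ℕ} {E : Finset (Fin n × Fin n)} {Λ : Type} (P : StatefulProtocol n E Λ)
    (x : Fin n → Bool) (S : Finset (Fin n)) (ℓ : {e // e ∈ E} → Λ) : {e // e ∈ E} → Λ :=
  fun e => if e.1.1 ∈ S then (P.react e.1.1 ℓ (x e.1.1)).1 e else ℓ e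

theorem runA_succ {n : ℕ} {E : Finset (Fin n × Fin n)} {Λ : Type} (P : StatefulProtocol n E Λ)
    (x : Fin n → Bool) (σ : ℕ → Finset (Fin n)) (ℓ : {e // e ∈ E} → Λ) (t : ℕ) :
    P.run x σ ℓ (t+1) = stepA P x (σ t) (P.run x σ ℓ t) := rfl

/-- walks in a finite digraph can be shortened -/
theorem short_walk {X : Type*} [Fintype X] (r : X → X → Prop) (a b : X) (l : ℕ) (w : ℕ → X)
    (h0 : w 0 = a) (hl : w l = b) (hs : ∀ i < l, r (w i) (w (i+1))) :
    ∃ l' ≤ Fintype.card X, ∃ w' : ℕ → X, w' 0 = a ∧ w' l' = b ∧ ∀ i < l', r (w' i) (w' (i+1)) := by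
  induction l using Nat.strong_induction_on generalizing w with
  | _ l ih =>
    by_cases hc : l ≤ Fintype.card X
    · exact ⟨l, hc, w, h0, hl, hs⟩
    · have : ∃ i j : Fin l, i ≠ j ∧ w i = w j := by
        apply Fintype.exists_ne_map_eq_of_card_lt (fun i : Fin l => w i)
        simpa using hc
      obtain ⟨i, j, hij, hw⟩ := this
      wlog hlt : i < j generalizing i j
      · exact this j i hij.symm hw.symm (lt_of_le_of_ne (not_lt.mp hlt) hij.symm)
      have hlt' : i.1 < j.1 := hlt
      have hj := j.2
      refine ih (l - (j - i)) (by omega) (fun k => if k ≤ i then w k else w (k + (j - i))) ?_ ?_ ?_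
      · simp [h0]
      · have : ¬ (l - (j.1 - i.1) ≤ i.1) := by omega
        simp only [this, if_false]
        rw [← hl]; congr 1; omega
      · intro k hk
        rcases lt_trichotomy k i.1 with h | h | h
        · have h1 : k ≤ i.1 := h.le
          have h2 : k + 1 ≤ i.1 := h
          simp only [h1, h2, if_true]
          exact hs k (by omega)
        · subst h
          have h2 : ¬ (i.1 + 1 ≤ i.1) := by omega
          simp only [le_refl, h2, if_true, if_false]
          rw [hw]
          have : i.1 + 1 + (j.1 - i.1) = j.1 + 1 := by omega
          rw [this]; exact hs _ hj
        · have h1 : ¬ k ≤ i.1 := by omega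
          have h2 : ¬ k + 1 ≤ i.1 := by omega
          simp only [h1, h2, if_false]
          have : k + 1 + (j.1 - i.1) = k + (j.1 - i.1) + 1 := by omega
          rw [this]; exact hs _ (by omega)

theorem fair_mono {n : ℕ} {σ : ℕ → Finset (Fin n)} {r r' : ℕ} (h : r ≤ r')
    (hf : StatelessProtocol.Fair σ r) : StatelessProtocol.Fair σ r' := by
  intro i t
  obtain ⟨s, h1, h2, h3⟩ := hf i t
  exact ⟨s, h1, by omega, h3⟩

theorem stabA_anti {n : ℕ} {E : Finset (Fin n × Fin n)} {Λ : Type} (P : StatefulProtocol n E Λ)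
    {r r' : ℕ} (h : r ≤ r') (hs : P.LabelRStabilizing r') : P.LabelRStabilizing r :=
  fun x ℓ σ hne hf => hs x ℓ σ hne (fair_mono h hf)

theorem stabB_anti {n : ℕ} {E : Finset (Fin n × Fin n)} {Λ : Type} (P : StatelessProtocol n E Λ)
    {r r' : ℕ} (h : r ≤ r') (hs : P.LabelRStabilizing r') : P.LabelRStabilizing r :=
  fun x ℓ σ hne hf => hs x ℓ σ hne (fair_mono h hf)

open Classical in
theorem loop_bound {n : ℕ} {E : Finset (Fin n × Fin n)} {Λ : Type} [Fintype Λ]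
    (P : StatefulProtocol n E Λ) (r : ℕ) (h : ¬ P.LabelRStabilizing r) :
    ¬ P.LabelRStabilizing (Fintype.card ({e // e ∈ E} → Λ) * (2 ^ n * 2)) := by
  unfold StatefulProtocol.LabelRStabilizing at h
  push Not at h
  obtain ⟨x, ℓ0, σ, hne, hf, hns⟩ := h
  set ρ := P.run x σ ℓ0 with hρ
  obtain ⟨u, hu⟩ := Finite.exists_infinite_fiber ρ
  have hinf : ∀ T, ∃ t, T ≤ t ∧ ρ t = u := by
    intro T
    have hS : (ρ ⁻¹' {u}).Infinite := Set.infinite_coe_iff.mp hu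
    obtain ⟨t, ht, hT⟩ := hS.exists_gt T
    exact ⟨t, hT.le, ht⟩
  obtain ⟨s, -, hs⟩ := hinf 0
  obtain ⟨t1, ht1, hne1⟩ := hns s
  obtain ⟨e, he, heu⟩ := hinf (t1 + s + r + 1)
  -- product walk
  let X := ({e // e ∈ E} → Λ) × (Finset (Fin n) × Bool)
  let R : X → X → Prop := fun p p' => ∃ S : Finset (Fin n), S.Nonempty ∧
    p'.1 = stepA P x S p.1 ∧ p'.2.1 = p.2.1 ∪ S ∧ p'.2.2 = (p.2.2 || decide (p'.1 ≠ u))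
  let w : ℕ → X := fun k => (ρ (s + k), Finset.univ.filter (fun i => ∃ j < k, i ∈ σ (s + j)),
    decide (∃ j ≤ k, ρ (s + j) ≠ u))
  have hw : ∀ i < e - s, R (w i) (w (i+1)) := by
    intro i hi
    refine ⟨σ (s + i), hne _, rfl, ?_, ?_⟩
    · ext a
      simp only [w, Finset.mem_union, Finset.mem_filter, Finset.mem_univ, true_and]
      constructor
      · rintro ⟨j, hj, h⟩
        rcases Nat.lt_succ_iff_lt_or_eq.mp hj with h' | h'
        · exact Or.inl ⟨j, h', h⟩
        · subst h'; exact Or.inr h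
      · rintro (⟨j, hj, h⟩ | h)
        · exact ⟨j, by omega, h⟩
        · exact ⟨i, by omega, h⟩
    · simp only [w]
      rw [← Bool.decide_or]
      apply decide_eq_decide.mpr
      constructor
      · rintro ⟨j, hj, h⟩
        rcases Nat.le_succ_iff.mp hj with h' | h'
        · exact Or.inl ⟨j, h', h⟩
        · subst h'; exact Or.inr h
      · rintro (⟨j, hj, h⟩ | h)
        · exact ⟨j, by omega, h⟩
        · exact ⟨i+1, le_rfl, h⟩
  obtain ⟨l, hl, w', h0, h1, hstep⟩ := short_walk R (u, ∅, false) (u, Finset.univ, true) (e - s) w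
    (by simp [w, hs]) (by
      have he' : s + (e - s) = e := by omega
      simp only [w, he', heu]
      congr 2
      · ext a
        simp only [Finset.mem_filter, Finset.mem_univ, true_and, iff_true]
        obtain ⟨k, hk1, hk2, hk3⟩ := hf a s
        exact ⟨k - s, by omega, by rwa [show s + (k - s) = k by omega]⟩
      · simp only [decide_eq_true_eq]
        refine ⟨t1 - s, by omega, ?_⟩
        rw [show s + (t1 - s) = t1 by omega, ← hs]; exact hne1) hw
  intro hstab
  have hl' : l ≤ Fintype.card ({e // e ∈ E} → Λ) * (2 ^ n * 2) := by
    simpa [X] using hl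
  have hstab := stabA_anti P hl' hstab
  have hlpos : 0 < l := by
    rcases Nat.eq_zero_or_pos l with h | h
    · subst h; rw [h0] at h1
      have := congrArg (fun p : X => p.2.2) h1
      simp at this
    · exact h
  choose S hS1 hS2 hS3 hS4 using hstep
  let τ : ℕ → Finset (Fin n) := fun t => S (t % l) (Nat.mod_lt _ hlpos)
  -- the sets collected
  have hcol : ∀ k, k ≤ l → ∀ i, i ∈ (w' k).2.1 → ∃ j, ∃ hj : j < l, j < k ∧ i ∈ S j hj := by
    intro k
    induction k with
    | zero => intro _ i hi; rw [h0] at hi; simp at hi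
    | succ k ih =>
      intro hk i hi
      rw [hS3 k (by omega), Finset.mem_union] at hi
      rcases hi with hi | hi
      · obtain ⟨j, hj, h, h'⟩ := ih (by omega) i hi
        exact ⟨j, hj, by omega, h'⟩
      · exact ⟨k, by omega, by omega, hi⟩
  have hchg : ∀ k, k ≤ l → (w' k).2.2 = true → ∃ j ≤ k, (w' j).1 ≠ u := by
    intro k
    induction k with
    | zero => intro _ hi; rw [h0] at hi; simp at hi
    | succ k ih =>
      intro hk hi
      rw [hS4 k (by omega), Bool.or_eq_true] at hi
      rcases hi with hi | hi
      · obtain ⟨j, hj, h⟩ := ih (by omega) hi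
        exact ⟨j, by omega, h⟩
      · exact ⟨k+1, le_rfl, by simpa using hi⟩
  have hrun : ∀ t, P.run x τ u t = (w' (t % l)).1 := by
    intro t
    induction t with
    | zero => simp [StatefulProtocol.run, h0]
    | succ t ih =>
      rw [runA_succ, ih]
      have := hS2 (t % l) (Nat.mod_lt _ hlpos)
      rw [← this]
      have hm := Nat.mod_lt t hlpos
      by_cases hc : t % l + 1 = l
      · rw [hc, h1]
        have : (t + 1) % l = 0 := by
          have hd := Nat.div_add_mod t l
          rw [show t + 1 = l * (t / l + 1) by rw [mul_add]; omega]
          exact Nat.mul_mod_right _ _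
        rw [this, h0]
      · have : (t + 1) % l = t % l + 1 := by
          have : 1 % l = 1 := Nat.mod_eq_of_lt (by omega)
          rw [Nat.add_mod_eq_ite, this, if_neg (by omega)]
        rw [this]
  obtain ⟨T, hT⟩ := hstab x u τ (fun t => hS1 _ _) (by
    intro i t
    obtain ⟨j, hj, -, hij⟩ := hcol l le_rfl i (by rw [h1]; simp)
    -- find s ∈ [t, t+l) with s % l = j
    have : ∃ s, t ≤ s ∧ s < t + l ∧ s % l = j := by
      have hm := Nat.mod_lt t hlpos
      have hd := Nat.div_add_mod t l
      by_cases hc : t % l ≤ j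
      · refine ⟨l * (t / l) + j, by omega, by omega, ?_⟩
        rw [Nat.mul_add_mod, Nat.mod_eq_of_lt hj]
      · refine ⟨l * (t / l + 1) + j, by rw [mul_add]; omega, by rw [mul_add]; omega, ?_⟩
        rw [Nat.mul_add_mod, Nat.mod_eq_of_lt hj]
    obtain ⟨s', a1, a2, a3⟩ := this
    refine ⟨s', a1, a2, ?_⟩
    subst a3; exact hij)
  obtain ⟨j, hj, hju⟩ := hchg l le_rfl (by rw [h1])
  have hjl : j < l := lt_of_le_of_ne hj (by rintro rfl; rw [h1] at hju; exact hju rfl)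
  have e1 := hT (l * T) (Nat.le_mul_of_pos_left _ hlpos)
  have e2 := hT (l * T + j) (le_trans (Nat.le_mul_of_pos_left _ hlpos) (by omega))
  rw [hrun] at e1 e2
  rw [Nat.mul_mod_right, h0] at e1
  rw [Nat.mul_add_mod, Nat.mod_eq_of_lt hjl, ← e1] at e2
  exact hju e2

end S2S

namespace S2S

section wrap
variable {V Λ : Type} [DecidableEq V]

/-- what node `v` sees -/
def vw (v : V) (M : V → V → Option Λ) : V → Option Λ := fun a => if a = v then none else M a v

def stp (act : V → (V → Option Λ) → V → Option Λ) (S : Finset V) (M : V → V → Option Λ) :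
    V → V → Option Λ := fun u => if u ∈ S then act u (vw u M) else M u

def Mrun (act : V → (V → Option Λ) → V → Option Λ) (σ : ℕ → Finset V) (M0 : V → V → Option Λ) :
    ℕ → V → V → Option Λ
  | 0 => M0
  | t + 1 => stp act (σ t) (Mrun act σ M0 t)

def MFair (σ : ℕ → Finset V) (r : ℕ) : Prop := ∀ i t, ∃ s, t ≤ s ∧ s < t + r ∧ i ∈ σ s

def wrap {N : ℕ} (φ : V ≃ Fin N) (act : V → (V → Option Λ) → V → Option Λ) :
    StatelessProtocol N (Kn N) (Option Λ) where
  react i ℓ _ := (fun e => act (φ.symm i)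
    (fun a => if h : φ a ≠ i then ℓ ⟨(φ a, i), by simp [Kn, h]⟩ else none) (φ.symm e.1.2), false)
  react_local := by
    intro i ℓ ℓ' x h
    have : (fun a => if h : φ a ≠ i then ℓ ⟨(φ a, i), by simp [Kn, h]⟩ else none)
      = (fun a => if h : φ a ≠ i then ℓ' ⟨(φ a, i), by simp [Kn, h]⟩ else none) := by
      funext a
      split_ifs with h1
      · exact h _ rfl
      · rfl
    simp only [this]

theorem wrap_run {N : ℕ} (φ : V ≃ Fin N) (act : V → (V → Option Λ) → V → Option Λ)
    (x : Fin N → Bool) (σ : ℕ → Finset (Fin N)) (ℓ0 : {e // e ∈ Kn N} → Option Λ)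
    (M0 : V → V → Option Λ) (hM : ∀ e, ℓ0 e = M0 (φ.symm e.1.1) (φ.symm e.1.2)) (t : ℕ) :
    ∀ e, (wrap φ act).run x σ ℓ0 t e =
      Mrun act (fun t => (σ t).map φ.symm.toEmbedding) M0 t (φ.symm e.1.1) (φ.symm e.1.2) := by
  induction t with
  | zero => exact hM
  | succ t ih =>
    intro e
    simp only [StatelessProtocol.run, Mrun, stp]
    have h1 : φ.symm e.1.1 ∈ (σ t).map φ.symm.toEmbedding ↔ e.1.1 ∈ σ t := by simp
    by_cases hc : e.1.1 ∈ σ t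
    · rw [if_pos hc, if_pos (h1.2 hc)]
      simp only [wrap]
      congr 2
      funext a
      unfold vw
      by_cases ha : a = φ.symm e.1.1
      · have : ¬ (φ a ≠ e.1.1) := by simp [ha]
        rw [dif_neg this, if_pos ha]
      · have : φ a ≠ e.1.1 := by intro h; apply ha; simp [← h]
        rw [dif_pos this, if_neg ha]
        have := ih ⟨(φ a, e.1.1), by simp [Kn, this]⟩
        simpa [wrap] using this
    · rw [if_neg hc, if_neg (fun h => hc (h1.1 h))]
      exact ih e

theorem wrap_stab {N : ℕ} (φ : V ≃ Fin N) (act : V → (V → Option Λ) → V → Option Λ) (r : ℕ)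
    (h : ∀ σ M0, MFair σ r → ∃ T, ∀ t, T ≤ t → Mrun act σ M0 t = Mrun act σ M0 T) :
    (wrap φ act).LabelRStabilizing r := by
  classical
  intro x ℓ0 σ _ hf
  let M0 : V → V → Option Λ := fun a b => if hab : φ a ≠ φ b then
    ℓ0 ⟨(φ a, φ b), by simpa [Kn] using hab⟩ else none
  have hM : ∀ e, ℓ0 e = M0 (φ.symm e.1.1) (φ.symm e.1.2) := by
    rintro ⟨⟨a, b⟩, hab⟩
    have : a ≠ b := by simpa [Kn] using hab
    simp [M0, this]
  obtain ⟨T, hT⟩ := h (fun t => (σ t).map φ.symm.toEmbedding) M0 (by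
    intro i t
    obtain ⟨s, h1, h2, h3⟩ := hf (φ i) t
    exact ⟨s, h1, h2, by simpa using h3⟩)
  refine ⟨T, fun t ht => ?_⟩
  funext e
  rw [wrap_run φ act x σ ℓ0 M0 hM, wrap_run φ act x σ ℓ0 M0 hM, hT t ht]

theorem wrap_not_stab {N : ℕ} (φ : V ≃ Fin N) (act : V → (V → Option Λ) → V → Option Λ) (r : ℕ)
    (σ : ℕ → Finset V) (M0 : V → V → Option Λ) (hne : ∀ t, (σ t).Nonempty) (hf : MFair σ r)
    (h : ∀ T, ∃ t, T ≤ t ∧ ∃ a b, a ≠ b ∧ Mrun act σ M0 t a b ≠ Mrun act σ M0 T a b) :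
    ¬ (wrap φ act).LabelRStabilizing r := by
  intro hs
  let σ' : ℕ → Finset (Fin N) := fun t => (σ t).map φ.toEmbedding
  have hσ : (fun t => (σ' t).map φ.symm.toEmbedding) = σ := by
    funext t; ext a; simp [σ']
  have hrun := wrap_run φ act (fun _ => false) σ' (fun e => M0 (φ.symm e.1.1) (φ.symm e.1.2)) M0
    (fun _ => rfl)
  rw [hσ] at hrun
  obtain ⟨T, hT⟩ := hs (fun _ => false) (fun e => M0 (φ.symm e.1.1) (φ.symm e.1.2)) σ'
    (fun t => by simpa [σ'] using hne t) (by
      intro i t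
      obtain ⟨s, h1, h2, h3⟩ := hf (φ.symm i) t
      exact ⟨s, h1, h2, by simpa [σ'] using h3⟩)
  obtain ⟨t, ht, a, b, hab, hd⟩ := h T
  apply hd
  have h1 := congrFun (hT t ht) ⟨(φ a, φ b), by simp [Kn, hab]⟩
  rw [hrun, hrun] at h1
  simpa using h1

end wrap

end S2S

namespace S2S
set_option linter.unusedSectionVars false

section simpleacts
variable {V Λ : Type} [DecidableEq V]

theorem const_stab (r : ℕ) (σ : ℕ → Finset V) (M0 : V → V → Option Λ) (hf : MFair σ r) :
    ∃ T, ∀ t, T ≤ t → Mrun (fun _ _ _ => none) σ M0 t = Mrun (fun _ _ _ => none) σ M0 T := by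
  have key : ∀ v s, v ∈ σ s → ∀ j, Mrun (fun _ _ _ => none) σ M0 (s + 1 + j) v = fun _ => none := by
    intro v s hs j
    induction j with
    | zero => simp [Mrun, stp, hs]
    | succ j ih =>
      rw [← add_assoc]
      rw [Mrun, stp]
      split_ifs
      · rfl
      · exact ih
  have all : ∀ t, r ≤ t → Mrun (fun _ _ _ => none) σ M0 t = fun _ _ => none := by
    intro t ht
    funext v
    obtain ⟨s, _, h2, h3⟩ := hf v 0
    have := key v s h3 (t - (s + 1))
    rwa [show s + 1 + (t - (s + 1)) = t by omega] at this
  exact ⟨r, fun t ht => by rw [all t ht, all r le_rfl]⟩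

def togg (l : Λ) (u0 u1 : V) : V → (V → Option Λ) → V → Option Λ :=
  fun v view _ => if view (if v = u0 then u1 else u0) = none then some l else none

theorem togg_run [Fintype V] (l : Λ) (u0 u1 : V) (h : u0 ≠ u1) (t : ℕ) :
    Mrun (togg l u0 u1) (fun _ => Finset.univ) (fun _ _ => none) t =
      fun _ _ => if t % 2 = 0 then none else some l := by
  induction t with
  | zero => rfl
  | succ t ih =>
    rw [Mrun, ih]
    funext a b
    simp only [stp, Finset.mem_univ, if_true, togg, vw]
    have : ¬ ((if a = u0 then u1 else u0) = a) := by
      split_ifs with hh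
      · subst hh; exact fun e => h e.symm
      · exact fun e => hh e.symm
    rw [if_neg this]
    rcases Nat.mod_two_eq_zero_or_one t with h0 | h0
    · rw [if_pos h0, if_pos rfl, if_neg (by omega)]
    · rw [if_neg (show ¬ t % 2 = 0 by omega), if_neg (by simp), if_pos (by omega)]

end simpleacts

section generic
variable {V Λ : Type} [DecidableEq V] [Fintype V]

def gd (L k : ℕ) : Prop := k % (L + 1) = 0 ∨ k % (L + 1) = L

structure Cyc (z : V) (C : ℕ → V → V → Option Λ) (L : ℕ) : Prop where
  hL : 3 ≤ L
  hcard : 3 ≤ Fintype.card V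
  hdet : ∀ v k k', (v = z → gd L k ∧ gd L k') → vw v (C k) = vw v (C k') →
    C (k + 1) v = C (k' + 1) v
  hone : ∀ k, ∃ v, (∀ w, w ≠ v → C (k + 1) w = C k w) ∧ (k % (L + 1) = L ↔ v = z)
  hsome : ∀ k v w, v ≠ w → w ≠ z → C k v w ≠ none
  hsomez : ∀ k v, gd L k → v ≠ z → C k v z ≠ none
  hzv : ∀ k k' v, gd L k → v ≠ z → C k' v z = C k v z → C k' v = C k v
  hmid : ∀ k k', gd L k → ¬ gd L k' → ∃ v, v ≠ z ∧ C k' v z ≠ C k v z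
  hzz : ∀ k, gd L k → ∀ k', ∃ k'', C k'' z = C k' z ∧ ∀ v, v ≠ z → C k'' v = C k v
  hflip : ∃ w, w ≠ z ∧ ∀ k, k % (L + 1) = 0 → C (k + (L + 1)) z w ≠ C k z w

def dead : V → Option Λ := fun _ => none

open Classical in
noncomputable def gact (z : V) (C : ℕ → V → V → Option Λ) (L : ℕ) (v : V) (view : V → Option Λ) :
    V → Option Λ :=
  if h : ∃ k, (v = z → gd L k) ∧ view = vw v (C k) then C (h.choose + 1) v else dead

variable {z : V} {C : ℕ → V → V → Option Λ} {L : ℕ}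

theorem act_of (H : Cyc z C L) (v : V) (k : ℕ) (hk : v = z → gd L k) :
    gact z C L v (vw v (C k)) = C (k + 1) v := by
  have h : ∃ k', (v = z → gd L k') ∧ vw v (C k) = vw v (C k') := ⟨k, hk, rfl⟩
  unfold gact
  rw [dif_pos h]
  exact (H.hdet v k h.choose (fun e => ⟨hk e, h.choose_spec.1 e⟩) h.choose_spec.2).symm

theorem act_dead (H : Cyc z C L) (v w : V) (hvw : w ≠ v) (view : V → Option Λ) (hw : view w = none) :
    gact z C L v view = dead := by
  unfold gact
  rw [dif_neg]
  rintro ⟨k, hk, rfl⟩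
  simp only [vw, if_neg hvw] at hw
  by_cases hz : v = z
  · subst hz
    exact H.hsomez k w (hk rfl) hvw hw
  · exact H.hsome k w v hvw hz hw

theorem act_mem (v : V) (view : V → Option Λ) :
    gact z C L v view = dead ∨ ∃ k, gact z C L v view = C k v := by
  unfold gact
  split_ifs with h
  · exact Or.inr ⟨_, rfl⟩
  · exact Or.inl rfl

theorem act_bad (H : Cyc z C L) (k : ℕ) (hk : ¬ gd L k) : gact z C L z (vw z (C k)) = dead := by
  unfold gact
  rw [dif_neg]
  rintro ⟨k', hk', he⟩
  obtain ⟨v, hv, hne⟩ := H.hmid k' k (hk' rfl) hk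
  have := congrFun he v
  simp only [vw, if_neg hv] at this
  exact hne this

theorem exists_third (H : Cyc z C L) (a b : V) : ∃ w, w ≠ a ∧ w ≠ b := by
  by_contra hc
  push Not at hc
  have : (Finset.univ : Finset V) ⊆ {a, b} := by
    intro w _
    by_cases h : w = a
    · simp [h]
    · simp [hc w h]
  have h1 := Finset.card_le_card this
  have h2 := Finset.card_le_two (a := a) (b := b)
  have := H.hcard
  rw [Finset.card_univ] at h1
  omega

theorem C_ne_dead (H : Cyc z C L) (k : ℕ) (v : V) : C k v ≠ dead := by
  obtain ⟨w, h1, h2⟩ := exists_third H v z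
  intro h
  exact H.hsome k v w (Ne.symm h1) h2 (by rw [h]; rfl)

/-- the configuration is phase `k`, up to one dead node -/
def Inv (C : ℕ → V → V → Option Λ) (M : V → V → Option Λ) (k : ℕ) : Prop :=
  ∃ v, (∀ w, w ≠ v → M w = C k w) ∧ (M v = C k v ∨ M v = dead)

theorem vw_congr (v : V) (M M' : V → V → Option Λ) (h : ∀ w, w ≠ v → M w = M' w) :
    vw v M = vw v M' := by
  funext a
  unfold vw
  split_ifs with h1
  · rfl
  · rw [h a h1]

theorem inv_of (M : V → V → Option Λ) (k : ℕ) (v0 : V)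
    (h : ∀ w, M w = C k w ∨ M w = dead)
    (h2 : ∀ u w, M u = dead → M w = dead → u = w) : Inv C M k := by
  by_cases hd : ∃ v, M v = dead
  · obtain ⟨v, hv⟩ := hd
    exact ⟨v, fun w hw => (h w).resolve_right (fun hh => hw (h2 w v hh hv)), Or.inr hv⟩
  · push Not at hd
    exact ⟨v0, fun w _ => (h w).resolve_right (hd w), h v0⟩

theorem one_of (H : Cyc z C L) (M : V → V → Option Λ) (k : ℕ) (v : V) (h : Inv C M k)
    (hv : M v = dead) : ∀ w, w ≠ v → M w = C k w := by
  obtain ⟨u, h1, h2⟩ := h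
  by_cases huv : u = v
  · subst huv; exact h1
  · exact absurd ((h1 v (Ne.symm huv)).symm.trans hv) (C_ne_dead H k v)

/-- one step from `Inv`; records the mover information -/
theorem inv_step (H : Cyc z C L) (M : V → V → Option Λ) (S : Finset V) (k : ℕ) (h : Inv C M k)
    (h2 : ∀ u w, stp (gact z C L) S M u = dead → stp (gact z C L) S M w = dead → u = w)
    (m : V) (hm : (∀ w, w ≠ m → C (k + 1) w = C k w) ∧ (k % (L + 1) = L ↔ m = z)) :
    (Inv C (stp (gact z C L) S M) k ∧
      (m ∈ S → stp (gact z C L) S M m = dead ∧ ¬ M m = dead)) ∨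
      Inv C (stp (gact z C L) S M) (k + 1) := by
  have hmz : m = z → gd L k := fun e => Or.inr (hm.2.2 e)
  by_cases hd : ∃ v, M v = dead
  · obtain ⟨v, hv⟩ := hd
    have hO := one_of H M k v h hv
    have hu : ∀ u, u ≠ v → u ∈ S → stp (gact z C L) S M u = dead := by
      intro u huv hu
      rw [stp, if_pos hu]
      exact act_dead H u v (Ne.symm huv) _ (by simp [vw, Ne.symm huv, hv, dead])
    have hn : ∀ u, u ≠ v → u ∉ S → stp (gact z C L) S M u = C k u := by
      intro u huv hu
      rw [stp, if_neg hu, hO u huv]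
    by_cases hvS : v ∈ S
    · have hvv : stp (gact z C L) S M v = gact z C L v (vw v (C k)) := by
        rw [stp, if_pos hvS, vw_congr v M (C k) hO]
      by_cases hg : v = z → gd L k
      · rw [act_of H v k hg] at hvv
        by_cases hvm : v = m
        · right
          refine inv_of _ _ z (fun w => ?_) h2
          by_cases hw : w = v
          · subst hw; exact Or.inl hvv
          · by_cases hwS : w ∈ S
            · exact Or.inr (hu w hw hwS)
            · left; rw [hn w hw hwS, hm.1 w (by rw [← hvm]; exact hw)]
        · left
          refine ⟨inv_of _ _ z (fun w => ?_) h2, ?_⟩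
          · by_cases hw : w = v
            · subst hw; left; rw [hvv, hm.1 w hvm]
            · by_cases hwS : w ∈ S
              · exact Or.inr (hu w hw hwS)
              · exact Or.inl (hn w hw hwS)
          · intro hmS
            refine ⟨hu m (Ne.symm hvm) hmS, ?_⟩
            rw [hO m (Ne.symm hvm)]
            exact C_ne_dead H k m
      · have hg' : v = z ∧ ¬ gd L k := by simpa using hg
        obtain ⟨rfl, hg'⟩ := hg'
        rw [act_bad H k hg'] at hvv
        left
        have hnm : ¬ v = m := fun e => hg' (hmz e.symm)
        refine ⟨inv_of _ _ v (fun w => ?_) h2, ?_⟩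
        · by_cases hw : w = v
          · subst hw; exact Or.inr hvv
          · by_cases hwS : w ∈ S
            · exact Or.inr (hu w hw hwS)
            · exact Or.inl (hn w hw hwS)
        · intro hmS
          refine ⟨hu m (Ne.symm hnm) hmS, ?_⟩
          rw [hO m (Ne.symm hnm)]
          exact C_ne_dead H k m
    · left
      have hvv : stp (gact z C L) S M v = dead := by rw [stp, if_neg hvS, hv]
      refine ⟨inv_of _ _ v (fun w => ?_) h2, ?_⟩
      · by_cases hw : w = v
        · subst hw; exact Or.inr hvv
        · by_cases hwS : w ∈ S
          · exact Or.inr (hu w hw hwS)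
          · exact Or.inl (hn w hw hwS)
      · intro hmS
        have hnm : m ≠ v := fun e => hvS (e ▸ hmS)
        refine ⟨hu m hnm hmS, ?_⟩
        rw [hO m hnm]
        exact C_ne_dead H k m
  · push Not at hd
    have hall : M = C k := by
      funext w
      obtain ⟨v, h1, h3⟩ := h
      by_cases hw : w = v
      · subst hw; exact h3.resolve_right (hd w)
      · exact h1 w hw
    subst hall
    have hS : ∀ w, w ∈ S → stp (gact z C L) S (C k) w = C (k + 1) w ∨
        (stp (gact z C L) S (C k) w = dead ∧ w ≠ m) := by
      intro w hw
      rw [stp, if_pos hw]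
      by_cases hg : w = z → gd L k
      · left; exact act_of H w k hg
      · right
        have hg' : w = z ∧ ¬ gd L k := by simpa using hg
        obtain ⟨rfl, hg'⟩ := hg'
        exact ⟨act_bad H k hg', fun e => hg' (hmz e.symm)⟩
    by_cases hmS : m ∈ S
    · right
      refine inv_of _ _ z (fun w => ?_) h2
      by_cases hw : w ∈ S
      · rcases hS w hw with h' | h'
        · exact Or.inl h'
        · exact Or.inr h'.1
      · left
        rw [stp, if_neg hw, hm.1 w (fun e => hw (e ▸ hmS))]
    · left
      refine ⟨inv_of _ _ z (fun w => ?_) h2, fun h => absurd h hmS⟩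
      by_cases hw : w ∈ S
      · rcases hS w hw with h' | h'
        · left; rw [h', hm.1 w (fun e => hmS (e ▸ hw))]
        · exact Or.inr h'.1
      · left
        rw [stp, if_neg hw]


theorem two_dead (H : Cyc z C L) (σ : ℕ → Finset V) (M0 : V → V → Option Λ)
    (r T : ℕ) (hf : MFair σ r) (u w : V) (huw : u ≠ w)
    (hu : Mrun (gact z C L) σ M0 T u = dead) (hw : Mrun (gact z C L) σ M0 T w = dead) :
    ∃ T, ∀ t, T ≤ t → Mrun (gact z C L) σ M0 t = Mrun (gact z C L) σ M0 T := by
  have h1 : ∀ j, Mrun (gact z C L) σ M0 (T + j) u = dead ∧ Mrun (gact z C L) σ M0 (T + j) w = dead := by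
    intro j
    induction j with
    | zero => exact ⟨hu, hw⟩
    | succ j ih =>
      rw [← add_assoc, Mrun]
      constructor
      · unfold stp
        split_ifs
        · exact act_dead H u w (Ne.symm huw) _ (by simp [vw, Ne.symm huw, ih.2, dead])
        · exact ih.1
      · unfold stp
        split_ifs
        · exact act_dead H w u huw _ (by simp [vw, huw, ih.1, dead])
        · exact ih.2
  have h2 : ∀ v s, T ≤ s → v ∈ σ s → Mrun (gact z C L) σ M0 (s + 1) v = dead := by
    intro v s hs hv
    obtain ⟨j, rfl⟩ := Nat.exists_eq_add_of_le hs
    rw [Mrun, stp, if_pos hv]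
    by_cases h : v = u
    · subst h
      exact act_dead H v w (Ne.symm huw) _ (by simp [vw, Ne.symm huw, (h1 j).2, dead])
    · exact act_dead H v u (Ne.symm h) _ (by simp [vw, Ne.symm h, (h1 j).1, dead])
  have h3 : ∀ v s, T ≤ s → v ∈ σ s → ∀ j, Mrun (gact z C L) σ M0 (s + 1 + j) v = dead := by
    intro v s hs hv j
    induction j with
    | zero => exact h2 v s hs hv
    | succ j ih =>
      by_cases hc : v ∈ σ (s + 1 + j)
      · exact h2 v (s + 1 + j) (by omega) hc
      · rw [← add_assoc, Mrun, stp, if_neg hc]; exact ih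
  have h4 : ∀ t, T + r ≤ t → Mrun (gact z C L) σ M0 t = fun _ => dead := by
    intro t ht
    funext v
    obtain ⟨s, h5, h6, h7⟩ := hf v T
    have := h3 v s h5 h7 (t - (s + 1))
    rwa [show s + 1 + (t - (s + 1)) = t by omega] at this
  exact ⟨T + r, fun t ht => by rw [h4 t ht, h4 _ le_rfl]⟩

theorem row_mem (_H : Cyc z C L) (σ : ℕ → Finset V) (M0 : V → V → Option Λ)
    (r : ℕ) (hf : MFair σ r) (t : ℕ) (ht : r ≤ t) (v : V) :
    Mrun (gact z C L) σ M0 t v = dead ∨ ∃ k, Mrun (gact z C L) σ M0 t v = C k v := by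
  have h2 : ∀ s, v ∈ σ s → ∀ j, Mrun (gact z C L) σ M0 (s + 1 + j) v = dead ∨
      ∃ k, Mrun (gact z C L) σ M0 (s + 1 + j) v = C k v := by
    intro s hs j
    induction j with
    | zero =>
      rw [add_zero, Mrun, stp, if_pos hs]
      exact act_mem v _
    | succ j ih =>
      rw [← add_assoc, Mrun, stp]
      split_ifs
      · exact act_mem v _
      · exact ih
  obtain ⟨s, _, h6, h7⟩ := hf v 0
  have := h2 s h7 (t - (s + 1))
  rwa [show s + 1 + (t - (s + 1)) = t by omega] at this

theorem gen_stab (H : Cyc z C L) (σ : ℕ → Finset V) (M0 : V → V → Option Λ)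
    (hf : MFair σ (L - 2)) :
    ∃ T, ∀ t, T ≤ t → Mrun (gact z C L) σ M0 t = Mrun (gact z C L) σ M0 T := by
  by_contra hcon
  have hL := H.hL
  set M := Mrun (gact z C L) σ M0 with hM
  have hMs : ∀ t, M (t + 1) = stp (gact z C L) (σ t) (M t) := fun t => rfl
  have N2 : ∀ t u w, M t u = dead → M t w = dead → u = w := by
    intro t u w hu hw
    by_contra huw
    exact hcon (two_dead H σ M0 (L - 2) t hf u w huw hu hw)
  -- basic step
  have stepI : ∀ t k, Inv C (M t) k → Inv C (M (t + 1)) k ∨ Inv C (M (t + 1)) (k + 1) := by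
    intro t k h
    obtain ⟨m, hm⟩ := H.hone k
    rcases inv_step H (M t) (σ t) k h (N2 (t + 1)) m hm with h1 | h1
    · exact Or.inl h1.1
    · exact Or.inr h1
  -- progress
  have prog : ∀ t k, Inv C (M t) k → ∃ t', t ≤ t' ∧ Inv C (M t') (k + 1) := by
    intro t k h
    by_contra hno
    push Not at hno
    obtain ⟨m, hm⟩ := H.hone k
    have hk : ∀ j, Inv C (M (t + j)) k := by
      intro j
      induction j with
      | zero => exact h
      | succ j ih =>
        rcases stepI _ _ ih with h1 | h1
        · exact h1
        · exact absurd h1 (hno _ (by omega))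
    have hk2 : ∀ s, t ≤ s → m ∈ σ s → M (s + 1) m = dead ∧ ¬ M s m = dead := by
      intro s hs hms
      obtain ⟨j, rfl⟩ := Nat.exists_eq_add_of_le hs
      rcases inv_step H (M (t + j)) (σ (t + j)) k (hk j) (N2 (t + j + 1)) m hm with h1 | h1
      · exact h1.2 hms
      · exact absurd h1 (hno (t + j + 1) (by omega))
    obtain ⟨s, h1, _, h3⟩ := hf m t
    have hd := (hk2 s h1 h3).1
    have hdj : ∀ j, M (s + 1 + j) m = dead := by
      intro j
      induction j with
      | zero => exact hd
      | succ j ih =>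
        by_cases hc : m ∈ σ (s + 1 + j)
        · exact absurd ih (hk2 _ (by omega) hc).2
        · rw [← add_assoc, hMs, stp, if_neg hc]; exact ih
    obtain ⟨s', h1', _, h3'⟩ := hf m (s + 1)
    obtain ⟨j, rfl⟩ := Nat.exists_eq_add_of_le h1'
    exact (hk2 _ (by omega) h3').2 (hdj j)
  have progn : ∀ j t k, Inv C (M t) k → ∃ t', t ≤ t' ∧ Inv C (M t') (k + j) := by
    intro j
    induction j with
    | zero => exact fun t k h => ⟨t, le_rfl, h⟩
    | succ j ih =>
      intro t k h
      obtain ⟨t', h1, h2⟩ := ih t k h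
      obtain ⟨t'', h3, h4⟩ := prog t' _ h2
      exact ⟨t'', h1.trans h3, h4⟩
  -- another node
  obtain ⟨w0, hw0, _⟩ := exists_third H z z
  -- z dead forever impossible
  have zdead : ∀ t, (∀ j, M (t + j) z = dead) → False := by
    intro t h
    obtain ⟨s, h1, _, h3⟩ := hf w0 t
    obtain ⟨j, rfl⟩ := Nat.exists_eq_add_of_le h1
    have hw : M (t + j + 1) w0 = dead := by
      rw [hMs, stp, if_pos h3]
      exact act_dead H w0 z (Ne.symm hw0) _ (by simp [vw, Ne.symm hw0, h j, dead])
    exact hw0 (N2 _ _ _ hw (h (j + 1)))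
  -- z dead in a bad phase
  have zbad : ∀ t k, Inv C (M t) k → M t z = dead → ¬ gd L k → False := by
    intro t k h hz hk
    refine zdead t ?_
    have : ∀ j, Inv C (M (t + j)) k ∧ M (t + j) z = dead := by
      intro j
      induction j with
      | zero => exact ⟨h, hz⟩
      | succ j ih =>
        have hO := one_of H _ k z ih.1 ih.2
        have hz' : M (t + j + 1) z = dead := by
          rw [hMs, stp]
          split_ifs
          · rw [vw_congr z _ (C k) hO]; exact act_bad H k hk
          · exact ih.2
        refine ⟨⟨z, fun w hw => ?_, Or.inr hz'⟩, hz'⟩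
        have hwS : w ∉ σ (t + j) := by
          intro hwS
          apply hw
          refine N2 (t + j + 1) w z ?_ hz'
          rw [hMs, stp, if_pos hwS]
          exact act_dead H w z (Ne.symm hw) _ (by simp [vw, Ne.symm hw, ih.2, dead])
        rw [← add_assoc, hMs, stp, if_neg hwS, hO w hw]
    exact fun j => (this j).2
  have claimZ : ∀ t k, Inv C (M t) k → z ∈ σ t → ¬ gd L k → ¬ gd L (k + 1) → False := by
    intro t k h hz hk hk1
    have hz' : M (t + 1) z = dead := by
      rw [hMs, stp, if_pos hz]
      by_cases hd : ∃ v, v ≠ z ∧ M t v = dead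
      · obtain ⟨v, hv, hvd⟩ := hd
        exact act_dead H z v hv _ (by simp [vw, hv, hvd, dead])
      · push Not at hd
        rw [vw_congr z _ (C k)]
        · exact act_bad H k hk
        · intro w hw
          obtain ⟨v, h1, h3⟩ := h
          by_cases hwv : w = v
          · subst hwv; exact h3.resolve_right (hd w hw)
          · exact h1 w hwv
    rcases stepI t k h with h1 | h1
    · exact zbad _ _ h1 hz' hk
    · exact zbad _ _ h1 hz' hk1
  -- start
  have start : ∃ t k, Inv C (M t) k := by
    by_cases hr : ∃ t, L - 2 ≤ t ∧ ∃ k, gd L k ∧ vw z (M t) = vw z (C k)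
    · obtain ⟨t, ht, k, hk, hv⟩ := hr
      have hrow : ∀ v, v ≠ z → M t v = C k v := by
        intro v hvz
        have he : M t v z = C k v z := by
          have := congrFun hv v
          simpa [vw, hvz] using this
        rcases row_mem H σ M0 _ hf t ht v with h1 | ⟨k', h1⟩
        · exfalso
          refine H.hsomez k v hk hvz ?_
          rw [← he, hM, h1]; rfl
        · rw [← hM] at h1
          rw [h1] at he ⊢
          exact H.hzv k k' v hk hvz he
      rcases row_mem H σ M0 _ hf t ht z with h1 | ⟨k', h1⟩
      · exact ⟨t, k, z, hrow, Or.inr h1⟩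
      · obtain ⟨k'', h2, h3⟩ := H.hzz k hk k'
        exact ⟨t, k'', z, fun w hw => by rw [hrow w hw, h3 w hw], Or.inl (by rw [h2]; exact h1)⟩
    · exfalso
      push Not at hr
      obtain ⟨s, h1, _, h3⟩ := hf z (L - 2)
      have hz : ∀ t, L - 2 ≤ t → z ∈ σ t → M (t + 1) z = dead := by
        intro t ht hz
        rw [hMs, stp, if_pos hz]
        unfold gact
        rw [dif_neg]
        rintro ⟨k, hk, he⟩
        exact hr t ht k (hk rfl) he
      refine zdead (s + 1) (fun j => ?_)
      induction j with
      | zero => exact hz s h1 h3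
      | succ j ih =>
        by_cases hc : z ∈ σ (s + 1 + j)
        · exact hz (s + 1 + j) (by omega) hc
        · rw [← add_assoc, hMs, stp, if_neg hc]; exact ih
  obtain ⟨t0, k0, h0⟩ := start
  obtain ⟨t1, _, h1⟩ := progn ((L + 1) * (k0 + 1) + 1 - k0) t0 k0 h0
  have hle : k0 ≤ (L + 1) * (k0 + 1) := by nlinarith
  rw [show k0 + ((L + 1) * (k0 + 1) + 1 - k0) = (L + 1) * (k0 + 1) + 1 by omega] at h1
  have win : ∀ i, ∃ d, d ≤ i ∧ Inv C (M (t1 + i)) ((L + 1) * (k0 + 1) + 1 + d) := by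
    intro i
    induction i with
    | zero => exact ⟨0, le_rfl, h1⟩
    | succ i ih =>
      obtain ⟨d, hd, hi⟩ := ih
      rcases stepI _ _ hi with h2 | h2
      · exact ⟨d, by omega, h2⟩
      · exact ⟨d + 1, by omega, h2⟩
  obtain ⟨s, hs1, hs2, hs3⟩ := hf z t1
  obtain ⟨i, rfl⟩ := Nat.exists_eq_add_of_le hs1
  obtain ⟨d, hd, hi⟩ := win i
  have hmod : ∀ d, d ≤ L - 2 → ¬ gd L ((L + 1) * (k0 + 1) + 1 + d) := by
    intro d hd
    have : ((L + 1) * (k0 + 1) + 1 + d) % (L + 1) = 1 + d := by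
      rw [add_assoc, Nat.mul_add_mod, Nat.mod_eq_of_lt (by omega)]
    unfold gd
    omega
  exact claimZ _ _ hi hs3 (hmod d (by omega)) (by
    have := hmod (d + 1) (by omega)
    rwa [← add_assoc] at this)


/-- the adversarial schedule -/
def advs (z : V) (L t : ℕ) : Finset V :=
  if t % (L + 1) = 0 ∨ t % (L + 1) = L - 1 then Finset.univ
  else if t % (L + 1) = L then {z} else Finset.univ.erase z

theorem adv_run (H : Cyc z C L) (t : ℕ) :
    (∀ v, v ≠ z → Mrun (gact z C L) (advs z L) (C 0) t v = C t v) ∧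
    (t % (L + 1) ≠ L → Mrun (gact z C L) (advs z L) (C 0) t z = C t z) := by
  have hL := H.hL
  induction t with
  | zero => exact ⟨fun v _ => rfl, fun _ => rfl⟩
  | succ t ih =>
    obtain ⟨h1, h2⟩ := ih
    obtain ⟨m, hm1, hm2⟩ := H.hone t
    have hlt : t % (L + 1) < L + 1 := Nat.mod_lt _ (by omega)
    have hsz : t % (L + 1) ≠ L → (t + 1) % (L + 1) = t % (L + 1) + 1 := by
      intro hne
      rw [Nat.add_mod, Nat.mod_eq_of_lt (show 1 < L + 1 by omega), Nat.mod_eq_of_lt (by omega)]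
    rw [Mrun]
    by_cases hlast : t % (L + 1) = L
    · have hS : advs z L t = {z} := by
        unfold advs
        rw [if_neg (by omega), if_pos hlast]
      have hmz := hm2.1 hlast
      constructor
      · intro v hv
        rw [stp, hS, if_neg (by simpa using hv), h1 v hv, hm1 v (by rw [hmz]; exact hv)]
      · intro _
        rw [stp, hS, if_pos (by simp), vw_congr z _ (C t) h1, act_of H z t (fun _ => Or.inr hlast)]
    · have hall : Mrun (gact z C L) (advs z L) (C 0) t = C t := by
        funext v
        by_cases hv : v = z
        · rw [hv]; exact h2 hlast
        · exact h1 v hv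
      rw [hall]
      have hmz : m ≠ z := fun e => hlast (hm2.2 e)
      constructor
      · intro v hv
        have hvS : v ∈ advs z L t := by
          unfold advs
          split_ifs <;> simp [hv]
        rw [stp, if_pos hvS, act_of H v t (fun e => absurd e hv)]
      · intro hne
        rw [hsz hlast] at hne
        by_cases h0 : t % (L + 1) = 0
        · have hvS : z ∈ advs z L t := by
            unfold advs
            rw [if_pos (Or.inl h0)]; simp
          rw [stp, if_pos hvS, act_of H z t (fun _ => Or.inl h0)]
        · have hvS : z ∉ advs z L t := by
            unfold advs
            rw [if_neg (by omega), if_neg hlast]; simp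
          rw [stp, if_neg hvS, hm1 z (Ne.symm hmz)]

theorem gen_not_stab {N : ℕ} (φ : V ≃ Fin N) (H : Cyc z C L) :
    ¬ (wrap φ (gact z C L)).LabelRStabilizing (L - 1) := by
  have hL := H.hL
  obtain ⟨w0, hw0, _⟩ := exists_third H z z
  refine wrap_not_stab φ _ (L - 1) (advs z L) (C 0) ?_ ?_ ?_
  · intro t
    unfold advs
    split_ifs
    · exact ⟨z, by simp⟩
    · exact ⟨z, by simp⟩
    · exact ⟨w0, by simp [hw0]⟩
  · intro i t
    have hlt : t % (L + 1) < L + 1 := Nat.mod_lt _ (by omega)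
    by_cases hi : i = z
    · subst hi
      by_cases he : t % (L + 1) = 0 ∨ t % (L + 1) = L - 1 ∨ t % (L + 1) = L
      · refine ⟨t, le_rfl, by omega, ?_⟩
        unfold advs
        split_ifs <;> simp
        omega
      · refine ⟨t + (L - 1 - t % (L + 1)), by omega, by omega, ?_⟩
        have : (t + (L - 1 - t % (L + 1))) % (L + 1) = L - 1 := by
          have hd := Nat.div_add_mod t (L + 1)
          rw [show t + (L - 1 - t % (L + 1)) = (L + 1) * (t / (L + 1)) + (L - 1) by omega,
            Nat.mul_add_mod, Nat.mod_eq_of_lt (by omega)]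
        unfold advs
        rw [if_pos (Or.inr this)]; simp
    · by_cases he : t % (L + 1) = L
      · refine ⟨t + 1, by omega, by omega, ?_⟩
        have : (t + 1) % (L + 1) = 0 := by
          have hd := Nat.div_add_mod t (L + 1)
          rw [show t + 1 = (L + 1) * (t / (L + 1) + 1) by rw [mul_add]; omega]
          exact Nat.mul_mod_right _ _
        unfold advs
        rw [if_pos (Or.inl this)]; simp
      · refine ⟨t, le_rfl, by omega, ?_⟩
        unfold advs
        rw [if_neg he]
        split_ifs <;> simp [hi]
  · intro T
    obtain ⟨w, hw, hfl⟩ := H.hflip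
    have h0 : ((L + 1) * T) % (L + 1) = 0 := Nat.mul_mod_right _ _
    have h1 : ((L + 1) * T + (L + 1)) % (L + 1) = 0 := by simp
    have e0 := (adv_run H ((L + 1) * T)).2 (by omega)
    have e1 := (adv_run H ((L + 1) * T + (L + 1))).2 (by omega)
    have hT : T ≤ (L + 1) * T := by nlinarith
    have hne := hfl _ h0
    rw [← e0, ← e1] at hne
    by_cases hc : Mrun (gact z C L) (advs z L) (C 0) ((L + 1) * T) z w =
        Mrun (gact z C L) (advs z L) (C 0) T z w
    · exact ⟨(L + 1) * T + (L + 1), by omega, z, w, Ne.symm hw, by rw [← hc]; exact hne⟩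
    · exact ⟨(L + 1) * T, hT, z, w, Ne.symm hw, hc⟩

end generic

end S2S

namespace S2S

@[ext] structure Dg where
  x : ℕ
  y : ℕ
  p : Bool
  b : Bool

def pr (a v : ℕ) : Bool := decide (min v a % 2 = 1)

def lev (T a : ℕ) (e drv dn : Bool) (d : Dg) : Dg where
  x := if dn then (if drv then min (d.y + 1) T else d.y - 1) else d.y
  y := d.x
  p := pr a d.y
  b := e && (if drv then (decide (d.y = T) && dn) else !(decide (d.y = 0) && dn))

def dnv (a : ℕ → ℕ) (st : ℕ → Dg) (j v : ℕ) : Bool :=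
  decide (j = 0) || ((st (j - 1)).b == pr (a j) v)

def cstep (T a : ℕ → ℕ) (m : ℕ) (em b : Bool) (st : ℕ → Dg) : ℕ → Dg := fun j =>
  if j < m then
    lev (T j) (a j) (em || decide (j + 1 < m)) (if j + 1 = m then b else (st (j + 1)).p)
      (dnv a st j (st j).y) (st j)
  else st j

def rst (T a : ℕ → ℕ) : ℕ → Bool → Bool → ℕ → Dg
  | 0, _, _ => fun _ => ⟨0, 0, false, false⟩
  | m + 1, em, b => Function.update (rst T a m true (pr (a m) (if b then T m else 0))) m
      ⟨if b then T m else 0, if b then T m else 0, pr (a m) (if b then T m else 0), em && b⟩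

def clen (T a : ℕ → ℕ) : ℕ → Bool → ℕ
  | 0, _ => 0
  | m + 1, em => 2 * T m + a m * (1 + clen T a m true) + em.toNat

def Mv (c c' : ℕ → Dg) : Prop :=
  ∃ j, (∀ i, i ≠ j → c' i = c i) ∧ c' j ≠ c j ∧
    ((c' j).y = (c j).y ∨ ((c' j).x = (c j).x ∧ (c' j).p = (c j).p ∧ (c' j).b = (c j).b ∧
      ((c' j).y = (c j).y + 1 ∨ (c j).y = (c' j).y + 1)))

inductive Pth (f : (ℕ → Dg) → ℕ → Dg) (Q : (ℕ → Dg) → Prop) : ℕ → (ℕ → Dg) → (ℕ → Dg) → Prop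
  | nil (c) : Pth f Q 0 c c
  | cons {n c c'} : Q c → Mv c (f c) → Pth f Q n (f c) c' → Pth f Q (n + 1) c c'

theorem Pth.trans {f : (ℕ → Dg) → ℕ → Dg} {Q : (ℕ → Dg) → Prop} {n n' : ℕ} {c c' c'' : ℕ → Dg}
    (h : Pth f Q n c c') (h' : Pth f Q n' c' c'') : Pth f Q (n + n') c c'' := by
  induction h with
  | nil => simpa using h'
  | cons h1 h2 _ ih =>
    rw [Nat.add_right_comm]
    exact Pth.cons h1 h2 (ih h')

theorem Pth.one {f : (ℕ → Dg) → ℕ → Dg} {Q : (ℕ → Dg) → Prop} {c c' : ℕ → Dg}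
    (h1 : Q c) (hf : f c = c') (h2 : Mv c c') : Pth f Q 1 c c' := by
  subst hf
  exact Pth.cons h1 h2 (Pth.nil _)

theorem cstep_congr (T a : ℕ → ℕ) (m : ℕ) (em b : Bool) (c c' : ℕ → Dg) (h : ∀ j, j < m → c j = c' j)
    (j : ℕ) (hj : j < m) : cstep T a m em b c j = cstep T a m em b c' j := by
  unfold cstep dnv
  rw [if_pos hj, if_pos hj, h j hj]
  have h1 : (if j + 1 = m then b else (c (j + 1)).p) = (if j + 1 = m then b else (c' (j + 1)).p) := by
    split_ifs with hh
    · rfl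
    · rw [h (j + 1) (by omega)]
  rw [h1, h (j - 1) (by omega)]

theorem cstep_update (T a : ℕ → ℕ) (m : ℕ) (em b : Bool) (low : ℕ → Dg) (d : Dg) :
    cstep T a (m + 1) em b (Function.update low m d) =
      Function.update (cstep T a m true d.p low) m
        (lev (T m) (a m) em b (dnv a low m d.y) d) := by
  funext j
  by_cases hj : j = m
  · subst hj
    rw [Function.update_self]
    unfold cstep
    rw [if_pos (by omega)]
    simp only [Function.update_self, lt_irrefl, decide_false, Bool.or_false, if_true]
    congr 1
    unfold dnv
    by_cases h0 : j = 0
    · simp [h0]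
    · rw [Function.update_of_ne (by omega)]
  · rw [Function.update_of_ne hj]
    by_cases hjm : j < m
    · rw [← cstep_congr T a m true d.p (Function.update low m d) low
        (fun i hi => Function.update_of_ne (by omega) _ _) j hjm]
      unfold cstep
      rw [if_pos (by omega), if_pos hjm]
      have h1 : j + 1 < m + 1 := by omega
      rw [if_neg (show ¬ j + 1 = m + 1 by omega)]
      by_cases h2 : j + 1 = m
      · rw [if_pos h2, h2]
        simp
      · rw [if_neg h2]
        simp [hjm]
    · unfold cstep
      rw [if_neg (by omega), if_neg hjm, Function.update_of_ne hj]

theorem mv_update (c c' : ℕ → Dg) (m : ℕ) (d : Dg) (h : Mv c c') (hm : c' m = c m) :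
    Mv (Function.update c m d) (Function.update c' m d) := by
  obtain ⟨j, h1, h2, h3⟩ := h
  have hj : j ≠ m := fun e => h2 (by rw [e]; exact hm)
  refine ⟨j, fun i hi => ?_, ?_, ?_⟩
  · by_cases him : i = m
    · subst him; simp
    · rw [Function.update_of_ne him, Function.update_of_ne him, h1 i hi]
  · rwa [Function.update_of_ne hj, Function.update_of_ne hj]
  · rwa [Function.update_of_ne hj, Function.update_of_ne hj]

theorem mv_top (c : ℕ → Dg) (m : ℕ) (d d' : Dg) (hne : d' ≠ d)
    (h : d'.y = d.y ∨ (d'.x = d.x ∧ d'.p = d.p ∧ d'.b = d.b ∧ (d'.y = d.y + 1 ∨ d.y = d'.y + 1))) :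
    Mv (Function.update c m d) (Function.update c m d') := by
  refine ⟨m, fun i hi => ?_, ?_, ?_⟩
  · rw [Function.update_of_ne hi, Function.update_of_ne hi]
  · simpa using hne
  · simpa using h

theorem pth_lift (T a : ℕ → ℕ) (m : ℕ) (em b : Bool) (d : Dg) (Q : (ℕ → Dg) → Prop)
    (Q' : (ℕ → Dg) → Prop)
    (hfix : ∀ c, Q c → lev (T m) (a m) em b (dnv a c m d.y) d = d)
    (hQ : ∀ c, Q' (Function.update c m d)) (n : ℕ) (c c' : ℕ → Dg)
    (h : Pth (cstep T a m true d.p) Q n c c') :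
    Pth (cstep T a (m + 1) em b) Q' n (Function.update c m d) (Function.update c' m d) := by
  induction h with
  | nil => exact Pth.nil _
  | @cons n c c' h1 h2 _ ih =>
    have e : cstep T a (m + 1) em b (Function.update c m d) =
        Function.update (cstep T a m true d.p c) m d := by
      rw [cstep_update, hfix c h1]
    refine Pth.cons (hQ c) ?_ ?_
    · rw [e]
      refine mv_update _ _ _ _ h2 ?_
      unfold cstep
      rw [if_neg (lt_irrefl m)]
    · rw [e]; exact ih

theorem rst_b (T a : ℕ → ℕ) (m : ℕ) (em b : Bool) (hm : 0 < m) :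
    (rst T a m em b (m - 1)).b = (em && b) := by
  obtain ⟨k, rfl⟩ : ∃ k, m = k + 1 := ⟨m - 1, by omega⟩
  simp [rst]

theorem dnv_rst (T a : ℕ → ℕ) (m v : ℕ) (p : Bool) (h : p = pr (a m) v) :
    dnv a (rst T a m true p) m v = true := by
  unfold dnv
  by_cases h0 : m = 0
  · simp [h0]
  · rw [rst_b T a m true p (by omega), h]
    simp

theorem rst_fix (T a : ℕ → ℕ) (m : ℕ) (em b : Bool) : cstep T a m em b (rst T a m em b) = rst T a m em b := by
  induction m generalizing em b with
  | zero => funext j; simp [cstep]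
  | succ m ih =>
    rw [rst, cstep_update, ih]
    congr 1
    rw [dnv_rst T a m _ _ rfl]
    cases b <;> simp [lev]

section
variable (T a : ℕ → ℕ) (m : ℕ) (em b : Bool)

/-- intermediate states -/
def Ast (v : ℕ) : ℕ → Dg :=
  Function.update (rst T a m true (pr (a m) v)) m ⟨v, v, pr (a m) v, em && !b⟩

theorem pth_move (v v' : ℕ) (h1 : (if b then min (v + 1) (T m) else v - 1) = v')
    (h2 : v' = v + 1 ∨ v = v' + 1)
    (h3 : (if b then decide (v = T m) else decide (v = 0)) = false)
    (ih : pr (a m) v' ≠ pr (a m) v → 0 < m ∧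
      Pth (cstep T a m true (pr (a m) v')) (fun c => (c (m - 1)).b = (true && !(pr (a m) v')))
        (clen T a m true) (rst T a m true (!(pr (a m) v'))) (rst T a m true (pr (a m) v'))) :
    Pth (cstep T a (m + 1) em b) (fun c => (c m).b = (em && !b))
      (2 + if pr (a m) v' ≠ pr (a m) v then 1 + clen T a m true else 0)
      (Ast T a m em b v) (Ast T a m em b v') := by
  set r := rst T a m true (pr (a m) v) with hr
  have hb : ∀ dn : Bool, (if b then (decide (v = T m) && dn) else !(decide (v = 0) && dn)) = !b := by
    intro dn
    cases b <;> simp_all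
  have hvv : v' ≠ v := by omega
  have s1 : Pth (cstep T a (m + 1) em b) (fun c => (c m).b = (em && !b)) 1
      (Ast T a m em b v) (Function.update r m ⟨v', v, pr (a m) v, em && !b⟩) := by
    refine Pth.one (by simp [Ast]) ?_ ?_
    · rw [Ast, cstep_update, rst_fix, dnv_rst T a m _ _ rfl]
      congr 1
      unfold lev
      simp only [hb, if_true, h1]
    · refine mv_top _ _ _ _ ?_ (Or.inl rfl)
      intro h
      exact hvv (congrArg Dg.x h)
  have s2 : Pth (cstep T a (m + 1) em b) (fun c => (c m).b = (em && !b)) 1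
      (Function.update r m ⟨v', v, pr (a m) v, em && !b⟩)
      (Function.update r m ⟨v', v', pr (a m) v, em && !b⟩) := by
    refine Pth.one (by simp) ?_ ?_
    · rw [cstep_update, rst_fix, dnv_rst T a m _ _ rfl]
      congr 1
      unfold lev
      simp only [hb, if_true, h1]
    · refine mv_top _ _ _ _ ?_ (Or.inr ⟨rfl, rfl, rfl, h2⟩)
      intro h
      exact hvv (congrArg Dg.y h)
  by_cases hp : pr (a m) v' = pr (a m) v
  · rw [if_neg (by simpa using hp)]
    have : Ast T a m em b v' = Function.update r m ⟨v', v', pr (a m) v, em && !b⟩ := by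
      rw [Ast, hp]
    rw [this]
    exact s1.trans s2
  · rw [if_pos hp]
    obtain ⟨hm, hl⟩ := ih hp
    have hneg : pr (a m) v = !(pr (a m) v') := by
      revert hp
      cases pr (a m) v <;> cases pr (a m) v' <;> simp
    have hdn0 : ∀ c : ℕ → Dg, (c (m - 1)).b = (!(pr (a m) v')) → dnv a c m v' = false := by
      intro c hc
      unfold dnv
      rw [hc]
      have : m ≠ 0 := by omega
      cases pr (a m) v' <;> simp [this]
    have hbf : (if b then (decide (v' = T m) && false) else !(decide (v' = 0) && false)) = !b := by
      cases b <;> simp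
    have s3 : Pth (cstep T a (m + 1) em b) (fun c => (c m).b = (em && !b)) 1
        (Function.update r m ⟨v', v', pr (a m) v, em && !b⟩)
        (Function.update r m ⟨v', v', pr (a m) v', em && !b⟩) := by
      refine Pth.one (by simp) ?_ ?_
      · rw [cstep_update, rst_fix, hdn0 _ (by rw [hr, rst_b T a m true _ hm, hneg]; simp)]
        congr 1
        unfold lev
        simp only [hbf]
        simp
      · refine mv_top _ _ _ _ ?_ (Or.inl rfl)
        intro h
        exact hp (congrArg Dg.p h)
    have s4 : Pth (cstep T a (m + 1) em b) (fun c => (c m).b = (em && !b)) (clen T a m true)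
        (Function.update r m ⟨v', v', pr (a m) v', em && !b⟩) (Ast T a m em b v') := by
      rw [hr, hneg, Ast]
      refine pth_lift T a m em b ⟨v', v', pr (a m) v', em && !b⟩ _ _ ?_ ?_ _ _ _ hl
      · intro c hc
        have hc' : (c (m - 1)).b = (!(pr (a m) v')) := by simpa using hc
        simp only [hdn0 c hc']
        unfold lev
        simp only [hbf]
        simp
      · intro c; simp
    have := (s1.trans s2).trans (s3.trans s4)
    exact this

end

theorem pr_tog (a v : ℕ) : (pr a (v + 1) ≠ pr a v) ↔ v < a := by
  unfold pr
  constructor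
  · intro h
    by_contra hc
    exact h (by rw [min_eq_right (by omega), min_eq_right (by omega)])
  · intro h
    rw [min_eq_left (by omega), min_eq_left (by omega)]
    simp only [ne_eq, decide_eq_decide]
    omega

theorem min_succ_sum (s a w : ℕ) : 2 * (s + 1) + min (s + 1) a * w =
    (2 * s + min s a * w) + (2 + if s < a then w else 0) := by
  split_ifs with h
  · rw [min_eq_left (by omega), min_eq_left (by omega)]; ring
  · rw [min_eq_right (by omega), min_eq_right (by omega)]; ring

theorem main_step (T a : ℕ → ℕ) (ha : ∀ j, a j ≤ T j) (m : ℕ) (em b : Bool)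
    (ih : ∀ v v', pr (a m) v' ≠ pr (a m) v → 0 < m ∧
      Pth (cstep T a m true (pr (a m) v')) (fun c => (c (m - 1)).b = (true && !(pr (a m) v')))
        (clen T a m true) (rst T a m true (!(pr (a m) v'))) (rst T a m true (pr (a m) v'))) :
    Pth (cstep T a (m + 1) em b) (fun c => (c m).b = (em && !b)) (clen T a (m + 1) em)
      (rst T a (m + 1) em (!b)) (rst T a (m + 1) em b) := by
  have hbody : ∃ v, Pth (cstep T a (m + 1) em b) (fun c => (c m).b = (em && !b))
      (2 * T m + a m * (1 + clen T a m true)) (rst T a (m + 1) em (!b)) (Ast T a m em b v) ∧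
      v = (if b then T m else 0) := by
    cases b with
    | true =>
      refine ⟨T m, ?_, rfl⟩
      have up : ∀ s, s ≤ T m → Pth (cstep T a (m + 1) em true) (fun c => (c m).b = (em && !true))
          (2 * s + min s (a m) * (1 + clen T a m true)) (Ast T a m em true 0)
          (Ast T a m em true s) := by
        intro s
        induction s with
        | zero => intro _; simpa using Pth.nil _
        | succ s ihs =>
          intro hs
          rw [min_succ_sum]
          refine (ihs (by omega)).trans ?_
          have := pth_move T a m em true s (s + 1) (by simp; omega) (Or.inl rfl)
            (by simp; omega) (ih _ _)
          simpa only [pr_tog] using this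
      have := up (T m) le_rfl
      rw [min_eq_right (ha m)] at this
      have e : rst T a (m + 1) em (!true) = Ast T a m em true 0 := by simp [rst, Ast]
      rw [e]; exact this
    | false =>
      refine ⟨0, ?_, rfl⟩
      have down : ∀ s, s ≤ T m → Pth (cstep T a (m + 1) em false) (fun c => (c m).b = (em && !false))
          (2 * s + min s (a m) * (1 + clen T a m true)) (Ast T a m em false s)
          (Ast T a m em false 0) := by
        intro s
        induction s with
        | zero => intro _; simpa using Pth.nil _
        | succ s ihs =>
          intro hs
          rw [min_succ_sum, Nat.add_comm (2 * s + _) _]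
          refine Pth.trans ?_ (ihs (by omega))
          have := pth_move T a m em false (s + 1) s (by simp) (Or.inr rfl)
            (by simp) (ih _ _)
          have hiff : (pr (a m) s ≠ pr (a m) (s + 1)) ↔ (s < a m) := by
            rw [ne_comm]; exact pr_tog _ _
          simpa only [hiff] using this
      have := down (T m) le_rfl
      rw [min_eq_right (ha m)] at this
      have e : rst T a (m + 1) em (!false) = Ast T a m em false (T m) := by simp [rst, Ast]
      rw [e]; exact this
  obtain ⟨v, hb, hv⟩ := hbody
  rw [clen]
  refine hb.trans ?_
  have er : rst T a (m + 1) em b = Function.update (rst T a m true (pr (a m) v)) m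
      ⟨v, v, pr (a m) v, em && b⟩ := by rw [rst, hv]
  cases em with
  | false =>
    have : rst T a (m + 1) false b = Ast T a m false b v := by rw [er, Ast]; simp
    rw [this]
    exact Pth.nil _
  | true =>
    refine Pth.one (by simp [Ast]) ?_ ?_
    · rw [Ast, cstep_update, rst_fix, dnv_rst T a m _ _ rfl, er]
      congr 1
      subst hv
      cases b <;> simp [lev]
    · rw [er, Ast]
      refine mv_top _ _ _ _ ?_ (Or.inl rfl)
      intro h
      have := congrArg Dg.b h
      cases b <;> simp at this

theorem main_path (T a : ℕ → ℕ) (ha : ∀ j, a j ≤ T j) (ha0 : a 0 = 0) (m : ℕ) (em b : Bool) :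
    Pth (cstep T a (m + 1) em b) (fun c => (c m).b = (em && !b)) (clen T a (m + 1) em)
      (rst T a (m + 1) em (!b)) (rst T a (m + 1) em b) := by
  induction m generalizing em b with
  | zero =>
    refine main_step T a ha 0 em b ?_
    intro v v' h
    exact absurd (by simp [pr, ha0]) h
  | succ m ihm =>
    refine main_step T a ha (m + 1) em b ?_
    intro v v' _
    exact ⟨by omega, ihm true _⟩

theorem Pth.iter {f : (ℕ → Dg) → ℕ → Dg} {Q : (ℕ → Dg) → Prop} {n : ℕ} {c c' : ℕ → Dg}
    (h : Pth f Q n c c') : f^[n] c = c' ∧ ∀ i, i < n → Mv (f^[i] c) (f^[i + 1] c) := by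
  induction h with
  | nil => exact ⟨rfl, fun i hi => absurd hi (by omega)⟩
  | cons _ h2 _ ih =>
    refine ⟨ih.1, fun i hi => ?_⟩
    cases i with
    | zero => exact h2
    | succ i => exact ih.2 i (by omega)

theorem mv_ne {c c' : ℕ → Dg} (h : Mv c c') : c' ≠ c := by
  obtain ⟨j, _, h, _⟩ := h
  exact fun e => h (by rw [e])

theorem cstep_bound (T a : ℕ → ℕ) (m : ℕ) (em b : Bool) (c : ℕ → Dg)
    (h : ∀ j, (c j).x ≤ T j ∧ (c j).y ≤ T j) (j : ℕ) :
    (cstep T a m em b c j).x ≤ T j ∧ (cstep T a m em b c j).y ≤ T j := by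
  have := h j
  unfold cstep
  by_cases hj : j < m
  · rw [if_pos hj]
    unfold lev
    refine ⟨?_, this.1⟩
    dsimp only
    split_ifs <;> omega
  · rw [if_neg hj]; exact this

theorem rst_bound (T a : ℕ → ℕ) (m : ℕ) (em b : Bool) (j : ℕ) :
    (rst T a m em b j).x ≤ T j ∧ (rst T a m em b j).y ≤ T j := by
  induction m generalizing em b with
  | zero => simp [rst]
  | succ m ih =>
    rw [rst]
    by_cases h : j = m
    · subst h
      rw [Function.update_self]
      cases b <;> simp
    · rw [Function.update_of_ne h]; exact ih _ _

theorem rst_high (T a : ℕ → ℕ) (m : ℕ) (em b : Bool) (j : ℕ) (hj : m ≤ j) :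
    rst T a m em b j = ⟨0, 0, false, false⟩ := by
  induction m generalizing em b with
  | zero => rfl
  | succ m ih =>
    rw [rst, Function.update_of_ne (by omega), ih _ _ (by omega)]

/-- the abstract cyclic orbit -/
structure Orb (T a : ℕ → ℕ) (m : ℕ) (em : Bool) (L : ℕ) (st : ℕ → ℕ → Dg) (bb : ℕ → Bool)
    (R : Bool → ℕ → Dg) : Prop where
  hstep : ∀ k, st (k + 1) = cstep T a m em (bb k) (st k)
  hmv : ∀ k, k % (L + 1) ≠ L → bb (k + 1) = bb k ∧ Mv (st k) (st (k + 1))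
  htop : ∀ k, k % (L + 1) = L → bb (k + 1) = !(bb k) ∧ st k = R (bb k) ∧ st (k + 1) = st k
  hbot : ∀ k, k % (L + 1) = 0 → st k = R (!(bb k))
  hmid : ∀ k b, ¬ gd L k → st k ≠ R b
  hbd : ∀ k j, (st k j).x ≤ T j ∧ (st k j).y ≤ T j
  hhigh : ∀ k j, m ≤ j → st k j = ⟨0, 0, false, false⟩
  hne : R true ≠ R false
  hflip : ∀ k, bb (k + (L + 1)) = !(bb k)

theorem orb_exists (T a : ℕ → ℕ) (ha : ∀ j, a j ≤ T j) (ha0 : a 0 = 0) (m : ℕ) (em : Bool) (L : ℕ)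
    (hL : L = clen T a (m + 1) em) (hL0 : 0 < L) :
    ∃ st bb R, Orb T a (m + 1) em L st bb R := by
  set R : Bool → ℕ → Dg := rst T a (m + 1) em with hR
  have hp : ∀ b, (cstep T a (m + 1) em b)^[L] (R (!b)) = R b ∧
      ∀ i, i < L → Mv ((cstep T a (m + 1) em b)^[i] (R (!b))) ((cstep T a (m + 1) em b)^[i + 1] (R (!b))) := by
    intro b
    rw [hL]
    exact (main_path T a ha ha0 m em b).iter
  have hfix : ∀ b, cstep T a (m + 1) em b (R b) = R b := fun b => rst_fix T a (m + 1) em b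
  have hfixn : ∀ b n, (cstep T a (m + 1) em b)^[n] (R b) = R b :=
    fun b n => Function.iterate_fixed (hfix b) n
  have hneR : ∀ b, R (!b) ≠ R b := by
    intro b h
    have := mv_ne ((hp b).2 0 hL0)
    apply this
    simp only [Function.iterate_zero, id_eq, zero_add, Function.iterate_one]
    rw [h, hfix]
  let bb : ℕ → Bool := fun k => decide ((k / (L + 1)) % 2 = 0)
  let st : ℕ → ℕ → Dg := fun k => (cstep T a (m + 1) em (bb k))^[k % (L + 1)] (R (!(bb k)))
  have hdm : ∀ k, k % (L + 1) = L → (k + 1) % (L + 1) = 0 ∧ (k + 1) / (L + 1) = k / (L + 1) + 1 := by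
    intro k hk
    have hd := Nat.div_add_mod k (L + 1)
    have : k + 1 = (L + 1) * (k / (L + 1) + 1) := by rw [mul_add]; omega
    constructor
    · rw [this]; exact Nat.mul_mod_right _ _
    · conv_lhs => rw [this]
      exact Nat.mul_div_cancel_left _ (by omega)
  have hdn : ∀ k, k % (L + 1) ≠ L →
      (k + 1) % (L + 1) = k % (L + 1) + 1 ∧ (k + 1) / (L + 1) = k / (L + 1) := by
    intro k hk
    have hd := Nat.div_add_mod k (L + 1)
    have hlt : k % (L + 1) < L + 1 := Nat.mod_lt _ (by omega)
    have : k + 1 = (L + 1) * (k / (L + 1)) + (k % (L + 1) + 1) := by omega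
    constructor
    · conv_lhs => rw [this]
      rw [Nat.mul_add_mod, Nat.mod_eq_of_lt (by omega)]
    · conv_lhs => rw [this]
      rw [Nat.mul_add_div (by omega), Nat.div_eq_of_lt (show k % (L + 1) + 1 < L + 1 by omega), add_zero]
  have hbt : ∀ k, k % (L + 1) = L → bb (k + 1) = !(bb k) := by
    intro k hk
    simp only [bb, (hdm k hk).2]
    rcases Nat.mod_two_eq_zero_or_one (k / (L + 1)) with h | h
    · have : (k / (L + 1) + 1) % 2 = 1 := by omega
      simp [h, this]
    · have : (k / (L + 1) + 1) % 2 = 0 := by omega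
      simp [h, this]
  have hbs : ∀ k, k % (L + 1) ≠ L → bb (k + 1) = bb k := by
    intro k hk
    simp only [bb, (hdn k hk).2]
  have htop : ∀ k, k % (L + 1) = L → st k = R (bb k) := by
    intro k hk
    simp only [st, hk]
    exact (hp _).1
  have hbot : ∀ k, k % (L + 1) = 0 → st k = R (!(bb k)) := by
    intro k hk
    simp only [st, hk]
    rfl
  have hst : ∀ k, st (k + 1) = cstep T a (m + 1) em (bb k) (st k) := by
    intro k
    by_cases hk : k % (L + 1) = L
    · rw [htop k hk, hfix, hbot _ (hdm k hk).1, hbt k hk, Bool.not_not]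
    · simp only [st, hbs k hk, (hdn k hk).1]
      rw [Function.iterate_succ_apply']
  refine ⟨st, bb, R, hst, ?_, ?_, hbot, ?_, ?_, ?_, hneR false, ?_⟩
  · intro k hk
    refine ⟨hbs k hk, ?_⟩
    have hlt : k % (L + 1) < L + 1 := Nat.mod_lt _ (by omega)
    simp only [st, hbs k hk, (hdn k hk).1]
    exact (hp _).2 _ (by omega)
  · intro k hk
    refine ⟨hbt k hk, htop k hk, ?_⟩
    rw [hst, htop k hk, hfix]
  · intro k b hg h
    have hlt : k % (L + 1) < L + 1 := Nat.mod_lt _ (by omega)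
    have hk0 : k % (L + 1) ≠ 0 := fun h => hg (Or.inl h)
    have hkL : k % (L + 1) ≠ L := fun h => hg (Or.inr h)
    by_cases hb : b = bb k
    · subst hb
      have := mv_ne ((hp (bb k)).2 (k % (L + 1)) (by omega))
      apply this
      rw [Function.iterate_succ_apply']
      change cstep T a (m + 1) em (bb k) (st k) = st k
      rw [h, hfix]
    · have hb' : b = !(bb k) := by
        revert hb; cases b <;> cases bb k <;> simp
      subst hb'
      have hper : ∀ i, (cstep T a (m + 1) em (bb k))^[k % (L + 1) * i] (R (!(bb k))) = R (!(bb k)) := by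
        intro i
        rw [Function.iterate_mul]
        exact Function.iterate_fixed h i
      have h1 := hper L
      obtain ⟨d, hd⟩ : ∃ d, k % (L + 1) * L = d + L := ⟨k % (L + 1) * L - L, by
        have : 1 * L ≤ k % (L + 1) * L := Nat.mul_le_mul_right _ (by omega)
        omega⟩
      rw [hd, Function.iterate_add_apply, (hp (bb k)).1, hfixn] at h1
      exact hneR _ h1.symm
  · intro k
    have : ∀ b n, ∀ j, (((cstep T a (m + 1) em b)^[n] (R (!b))) j).x ≤ T j ∧
        (((cstep T a (m + 1) em b)^[n] (R (!b))) j).y ≤ T j := by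
      intro b n
      induction n with
      | zero => exact rst_bound T a _ _ _
      | succ n ih =>
        rw [Function.iterate_succ_apply']
        exact cstep_bound T a _ _ _ _ ih
    exact this _ _
  · intro k j hj
    have : ∀ b n, ((cstep T a (m + 1) em b)^[n] (R (!b))) j = ⟨0, 0, false, false⟩ := by
      intro b n
      induction n with
      | zero => exact rst_high T a _ _ _ _ hj
      | succ n ih =>
        rw [Function.iterate_succ_apply', cstep, if_neg (by omega)]
        exact ih
    exact this _ _
  · intro k
    simp only [bb]
    rw [Nat.add_div_right k (by omega : 0 < L + 1)]
    rcases Nat.mod_two_eq_zero_or_one (k / (L + 1)) with h | h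
    · have : (k / (L + 1) + 1) % 2 = 1 := by omega
      simp [h, this]
    · have : (k / (L + 1) + 1) % 2 = 0 := by omega
      simp [h, this]

end S2S

namespace S2S

theorem gray (Λ : Type) [Fintype Λ] [Nonempty Λ] (l : ℕ) :
    ∃ g : ℕ → Fin l → Λ,
      (∀ i j, i < Fintype.card Λ ^ l → j < Fintype.card Λ ^ l → g i = g j → i = j) ∧
      ∀ i, i + 1 < Fintype.card Λ ^ l → ∃ c, ∀ c', c' ≠ c → g (i + 1) c' = g i c' := by
  classical
  set q := Fintype.card Λ with hq
  have hq0 : 0 < q := Fintype.card_pos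
  obtain ⟨d, hd⟩ : ∃ d : ℕ → Λ, ∀ i j, i < q → j < q → d i = d j → i = j := by
    let e := Fintype.equivFin Λ
    refine ⟨fun i => if h : i < q then e.symm ⟨i, h⟩ else e.symm ⟨0, hq0⟩, ?_⟩
    intro i j hi hj h
    simp only [dif_pos hi, dif_pos hj] at h
    have := e.symm.injective h
    simpa using this
  induction l with
  | zero =>
    refine ⟨fun _ => Fin.elim0, ?_, ?_⟩
    · intro i j hi hj _
      simp at hi hj; omega
    · intro i hi; simp at hi
  | succ l ih =>
    obtain ⟨g, hg1, hg2⟩ := ih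
    set K := q ^ l with hK
    have hK0 : 0 < K := pow_pos hq0 l
    let idx : ℕ → ℕ := fun k => if (k / K) % 2 = 0 then k % K else K - 1 - k % K
    have hqK : q ^ (l + 1) = K * q := pow_succ q l
    have hidx : ∀ k, idx k < K := by
      intro k
      have := Nat.mod_lt k hK0
      simp only [idx]
      split_ifs <;> omega
    have hadj : ∀ i j, i < K → j < K → (j = i + 1 ∨ i = j + 1) → ∃ c, ∀ c', c' ≠ c → g j c' = g i c' := by
      intro i j hi hj h
      rcases h with rfl | rfl
      · exact hg2 i hj
      · obtain ⟨c, hc⟩ := hg2 j hi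
        exact ⟨c, fun c' h => (hc c' h).symm⟩
    refine ⟨fun k => Fin.cons (d (k / K)) (g (idx k)), ?_, ?_⟩
    · intro i j hi hj h
      rw [hqK] at hi hj
      have h1 : d (i / K) = d (j / K) := by
        have := congrFun h 0
        simpa using this
      have h2 : g (idx i) = g (idx j) := by
        funext c
        have := congrFun h c.succ
        simpa using this
      have h3 : i / K = j / K := hd _ _ (Nat.div_lt_of_lt_mul hi) (Nat.div_lt_of_lt_mul hj) h1
      have h4 := hg1 _ _ (hidx i) (hidx j) h2
      have hi' := Nat.mod_lt i hK0
      have hj' := Nat.mod_lt j hK0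
      have h5 : i % K = j % K := by
        simp only [idx, h3] at h4
        split_ifs at h4 <;> omega
      rw [← Nat.div_add_mod i K, ← Nat.div_add_mod j K, h3, h5]
    · intro i hi
      have hd := Nat.div_add_mod i K
      have hlt := Nat.mod_lt i hK0
      by_cases hc : i % K = K - 1
      · have e : i + 1 = K * (i / K + 1) := by rw [mul_add]; omega
        have h1 : (i + 1) % K = 0 := by rw [e]; exact Nat.mul_mod_right _ _
        have h2 : (i + 1) / K = i / K + 1 := by
          conv_lhs => rw [e]
          exact Nat.mul_div_cancel_left _ hK0
        refine ⟨0, fun c' hc' => ?_⟩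
        obtain ⟨c, rfl⟩ := Fin.exists_succ_eq.2 hc'
        simp only [Fin.cons_succ]
        congr 1
        have : idx (i + 1) = idx i := by
          simp only [idx, h1, h2, hc]
          split_ifs <;> omega
        rw [this]
      · have e : i + 1 = K * (i / K) + (i % K + 1) := by omega
        have h1 : (i + 1) % K = i % K + 1 := by
          conv_lhs => rw [e]
          rw [Nat.mul_add_mod, Nat.mod_eq_of_lt (by omega)]
        have h2 : (i + 1) / K = i / K := by
          conv_lhs => rw [e]
          rw [Nat.mul_add_div hK0, Nat.div_eq_of_lt (show i % K + 1 < K by omega), add_zero]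
        have h3 : idx (i + 1) = idx i + 1 ∨ idx i = idx (i + 1) + 1 := by
          simp only [idx, h1, h2]
          split_ifs <;> omega
        obtain ⟨c, hc⟩ := hadj _ _ (hidx i) (hidx (i + 1)) h3
        refine ⟨c.succ, fun c' hc' => ?_⟩
        refine Fin.cases ?_ (fun c'' => ?_) c' hc'
        · intro _; simp [h2]
        · intro h
          simp only [Fin.cons_succ]
          exact hc c'' (fun e => h (by rw [e]))

section build
variable {Λ : Type} (bl : Bool → Λ) {n l : ℕ} (g : ℕ → Fin l → Λ)

open Classical in
noncomputable def stat {α : Type} (bot top cur : α) : Option Λ :=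
  if cur = bot then some (bl false) else if cur = top then some (bl true) else none

theorem stat_inj (hbl : bl true ≠ bl false) {α : Type} (bot top cur r : α) (hr : r = bot ∨ r = top)
    (h : stat bl bot top cur = stat bl bot top r) : cur = r := by
  unfold stat at h
  rcases hr with rfl | rfl
  · split_ifs at h <;> simp_all
  · split_ifs at h <;> simp_all

theorem stat_some {α : Type} (bot top r : α) (hr : r = bot ∨ r = top) :
    stat bl bot top r ≠ none := by
  unfold stat
  rcases hr with rfl | rfl
  · simp
  · by_cases h : r = bot <;> simp [h]

def pD (c : ℕ → Dg) (i : Fin n) : ℕ × Bool × Bool := ((c i).x, (c i).p, (c i).b)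

def pE (n : ℕ) (c : ℕ → Dg) (j : Fin l) : Fin n → Λ := fun i => g (c i).y j

noncomputable def rowD (R : Bool → ℕ → Dg) (i : Fin n) (pt : ℕ × Bool × Bool) :
    Option (Fin n ⊕ Fin l) → Option Λ
  | none => stat bl (pD (R false) i) (pD (R true) i) pt
  | some (Sum.inl i') => some (bl (if i'.val = i.val + 1 then pt.2.2 else pt.2.1))
  | some (Sum.inr j) => some (g pt.1 j)

noncomputable def rowE (R : Bool → ℕ → Dg) (j : Fin l) (pt : Fin n → Λ) :
    Option (Fin n ⊕ Fin l) → Option Λ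
  | none => stat bl (pE g n (R false) j) (pE g n (R true) j) pt
  | some (Sum.inl i) => some (pt i)
  | some (Sum.inr _) => some (bl false)

noncomputable def CC (R : Bool → ℕ → Dg) (st : ℕ → ℕ → Dg) (bb : ℕ → Bool) (k : ℕ) :
    Option (Fin n ⊕ Fin l) → Option (Fin n ⊕ Fin l) → Option Λ
  | none => fun _ => some (bl (bb k))
  | some (Sum.inl i) => rowD bl g R i (pD (st k) i)
  | some (Sum.inr j) => rowE bl g R j (pE g n (st k) j)

variable {T a : ℕ → ℕ} {em : Bool} {L : ℕ} {st : ℕ → ℕ → Dg} {bb : ℕ → Bool} {R : Bool → ℕ → Dg}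

theorem orb_gd (O : Orb T a n em L st bb R) (hL : 3 ≤ L) (k : ℕ) (hk : gd L k) :
    st k = R (!(bb (k + 1))) := by
  rcases hk with h | h
  · rw [(O.hmv k (by omega)).1]; exact O.hbot k h
  · rw [(O.htop k h).1, Bool.not_not]; exact (O.htop k h).2.1

theorem orb_rinj (O : Orb T a n em L st bb R) (b b' : Bool) (h : R b = R b') : b = b' := by
  cases b <;> cases b' <;> first | rfl | exact absurd h O.hne | exact absurd h.symm O.hne

theorem st_ext (O : Orb T a n em L st bb R) {N : ℕ} (hT : ∀ j, T j < N)
    (hg : ∀ i j, i < N → j < N → g i = g j → i = j) (k k' : ℕ)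
    (h1 : ∀ i : Fin n, pD (st k) i = pD (st k') i)
    (h2 : ∀ j : Fin l, pE g n (st k) j = pE g n (st k') j) : st k = st k' := by
  funext j
  by_cases hj : j < n
  · have h3 := h1 ⟨j, hj⟩
    simp only [pD, Prod.mk.injEq] at h3
    have h4 : (st k j).y = (st k' j).y := by
      refine hg _ _ (lt_of_le_of_lt (O.hbd k j).2 (hT j)) (lt_of_le_of_lt (O.hbd k' j).2 (hT j)) ?_
      funext c
      exact congrFun (h2 c) ⟨j, hj⟩
    exact Dg.ext h3.1 h4 h3.2.1 h3.2.2
  · rw [O.hhigh k j (by omega), O.hhigh k' j (by omega)]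

theorem lev_part (T a : ℕ) (e drv dn : Bool) (d d' : Dg) (h : d.y = d'.y) :
    (lev T a e drv dn d).x = (lev T a e drv dn d').x ∧ (lev T a e drv dn d).p = (lev T a e drv dn d').p ∧
    (lev T a e drv dn d).b = (lev T a e drv dn d').b := by
  simp [lev, h]

theorem build (hbl : bl true ≠ bl false) (O : Orb T a n em L st bb R) (hL : 3 ≤ L) (hn : 2 ≤ n)
    {N : ℕ} (hT : ∀ j, T j < N)
    (hg : ∀ i j, i < N → j < N → g i = g j → i = j)
    (hg2 : ∀ i, i + 1 < N → ∃ c, ∀ c', c' ≠ c → g (i + 1) c' = g i c') :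
    Cyc (none : Option (Fin n ⊕ Fin l)) (CC bl g R st bb) L := by
  have hblinj : ∀ b b', bl b = bl b' → b = b' := by
    intro b b' h
    cases b <;> cases b' <;> first | rfl | exact absurd h hbl | exact absurd h.symm hbl
  have hR : ∀ k, gd L k → ∃ b, st k = R b := fun k hk => ⟨_, orb_gd O hL k hk⟩
  have hDr : ∀ k, gd L k → ∀ i : Fin n, pD (st k) i = pD (R false) i ∨ pD (st k) i = pD (R true) i := by
    intro k hk i
    obtain ⟨b, hb⟩ := hR k hk
    rw [hb]; cases b <;> simp
  have hEr : ∀ k, gd L k → ∀ j : Fin l, pE g n (st k) j = pE g n (R false) j ∨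
      pE g n (st k) j = pE g n (R true) j := by
    intro k hk j
    obtain ⟨b, hb⟩ := hR k hk
    rw [hb]; cases b <;> simp
  have hzv : ∀ k k' v, gd L k → v ≠ none → CC bl g R st bb k' v none = CC bl g R st bb k v none →
      CC bl g R st bb k' v = CC (n := n) (l := l) bl g R st bb k v := by
    intro k k' v hk hv h
    rcases v with _ | i | j
    · exact absurd rfl hv
    · have := stat_inj bl hbl _ _ _ _ (hDr k hk i) h
      simp only [CC, this]
    · have := stat_inj bl hbl _ _ _ _ (hEr k hk j) h
      simp only [CC, this]
  have hsteq : ∀ k k', gd L k → (∀ v : Option (Fin n ⊕ Fin l), v ≠ none →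
      CC bl g R st bb k' v none = CC bl g R st bb k v none) → st k' = st k := by
    intro k k' hk h
    refine st_ext g O hT hg k' k (fun i => ?_) (fun j => ?_)
    · exact stat_inj bl hbl _ _ _ _ (hDr k hk i) (h (some (Sum.inl i)) (by simp))
    · exact stat_inj bl hbl _ _ _ _ (hEr k hk j) (h (some (Sum.inr j)) (by simp))
  refine ⟨hL, ?_, ?_, ?_, ?_, ?_, hzv, ?_, ?_, ?_⟩
  · simp; omega
  · -- determinism
    intro v k k' hz hv
    have hv' : ∀ w, w ≠ v → CC bl g R st bb k w v = CC bl g R st bb k' w v := by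
      intro w hw
      have := congrFun hv w
      simpa [vw, hw] using this
    rcases v with _ | i | j
    · have h1 := hz rfl
      have h2 := hsteq k' k h1.2 hv'
      rw [orb_gd O hL k h1.1, orb_gd O hL k' h1.2] at h2
      have h3 := orb_rinj O _ _ h2
      simp only [CC]
      rw [show bb (k + 1) = bb (k' + 1) by simpa using h3]
    · have hy : (st k i).y = (st k' i).y := by
        refine hg _ _ (lt_of_le_of_lt (O.hbd k i).2 (hT i)) (lt_of_le_of_lt (O.hbd k' i).2 (hT i)) ?_
        funext c
        have := hv' (some (Sum.inr c)) (by simp)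
        simpa [CC, rowE, pE] using this
      have hdrv : (if i.val + 1 = n then bb k else (st k (i.val + 1)).p) =
          (if i.val + 1 = n then bb k' else (st k' (i.val + 1)).p) := by
        split_ifs with hin
        · have := hv' none (by simp)
          exact hblinj _ _ (by simpa [CC] using this)
        · have := hv' (some (Sum.inl ⟨i.val + 1, by omega⟩)) (by simp [Fin.ext_iff])
          simp only [CC, rowD, Option.some.injEq] at this
          have h2 := hblinj _ _ this
          rw [if_neg (by omega), if_neg (by omega)] at h2
          exact h2
      have hdn : dnv a (st k) i.val (st k i).y = dnv a (st k') i.val (st k' i).y := by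
        unfold dnv
        rw [hy]
        by_cases hi0 : i.val = 0
        · simp [hi0]
        · have := hv' (some (Sum.inl ⟨i.val - 1, by omega⟩)) (by simp [Fin.ext_iff]; omega)
          simp only [CC, rowD, Option.some.injEq] at this
          have h2 := hblinj _ _ this
          rw [if_pos (by omega), if_pos (by omega)] at h2
          simp only [pD] at h2
          rw [h2]
      have : pD (st (k + 1)) i = pD (st (k' + 1)) i := by
        unfold pD
        rw [O.hstep, O.hstep]
        unfold cstep
        rw [if_pos i.2, if_pos i.2, hdrv, hdn]
        obtain ⟨e1, e2, e3⟩ := lev_part (T i) (a i) (em || decide (i.val + 1 < n))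
          (if i.val + 1 = n then bb k' else (st k' (i.val + 1)).p) (dnv a (st k') i.val (st k' i).y)
          (st k i) (st k' i) hy
        rw [e1, e2, e3]
      simp only [CC, this]
    · have : pE g n (st (k + 1)) j = pE g n (st (k' + 1)) j := by
        funext i
        have h1 := hv' (some (Sum.inl i)) (by simp)
        simp only [CC, rowD, pD, Option.some.injEq] at h1
        unfold pE
        rw [O.hstep, O.hstep]
        unfold cstep
        rw [if_pos i.2, if_pos i.2]
        exact h1
      simp only [CC, this]
  · -- single mover
    intro k
    by_cases hk : k % (L + 1) = L
    · refine ⟨none, fun w hw => ?_, by simp [hk]⟩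
      have hs := (O.htop k hk).2.2
      rcases w with _ | i | j
      · exact absurd rfl hw
      · simp only [CC, hs]
      · simp only [CC, hs]
    · obtain ⟨hb, jj, h1, h2, h3⟩ := O.hmv k hk
      have hjn : jj < n := by
        by_contra hc
        exact h2 (by rw [O.hhigh k jj (by omega), O.hhigh (k + 1) jj (by omega)])
      rcases h3 with hy | ⟨hx, hp, hbt, hy⟩
      · refine ⟨some (Sum.inl ⟨jj, hjn⟩), fun w hw => ?_, by simp [hk]⟩
        rcases w with _ | i | j
        · simp only [CC, hb]
        · have : i.val ≠ jj := by
            intro e; apply hw; subst e; rfl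
          simp only [CC, pD, h1 i.val this]
        · have : pE g n (st (k + 1)) j = pE g n (st k) j := by
            funext i
            unfold pE
            by_cases e : i.val = jj
            · rw [e, hy]
            · rw [h1 _ e]
          simp only [CC, this]
      · obtain ⟨c, hc⟩ : ∃ c, ∀ c', c' ≠ c → g (st (k + 1) jj).y c' = g (st k jj).y c' := by
          have b1 := lt_of_le_of_lt (O.hbd k jj).2 (hT jj)
          have b2 := lt_of_le_of_lt (O.hbd (k + 1) jj).2 (hT jj)
          rcases hy with hy | hy
          · rw [hy] at b2 ⊢; exact hg2 _ b2
          · rw [hy] at b1 ⊢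
            obtain ⟨c, hc⟩ := hg2 _ b1
            exact ⟨c, fun c' h => (hc c' h).symm⟩
        refine ⟨some (Sum.inr c), fun w hw => ?_, by simp [hk]⟩
        rcases w with _ | i | j
        · simp only [CC, hb]
        · have : pD (st (k + 1)) i = pD (st k) i := by
            unfold pD
            by_cases e : i.val = jj
            · rw [e, hx, hp, hbt]
            · rw [h1 _ e]
          simp only [CC, this]
        · have : pE g n (st (k + 1)) j = pE g n (st k) j := by
            funext i
            unfold pE
            by_cases e : i.val = jj
            · rw [e, hc j (fun e => hw (by rw [e]))]
            · rw [h1 _ e]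
          simp only [CC, this]
  · intro k v w _ hw
    rcases w with _ | i | j
    · exact absurd rfl hw
    · rcases v with _ | i' | j' <;> simp [CC, rowD, rowE]
    · rcases v with _ | i' | j' <;> simp [CC, rowD, rowE]
  · intro k v hk hv
    rcases v with _ | i | j
    · exact absurd rfl hv
    · exact stat_some bl _ _ _ (hDr k hk i)
    · exact stat_some bl _ _ _ (hEr k hk j)
  · intro k k' hk hk'
    by_contra hc
    push Not at hc
    have := hsteq k k' hk hc
    obtain ⟨b, hb⟩ := hR k hk
    exact O.hmid k' b hk' (this.trans hb)
  · intro k hk k'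
    obtain ⟨b, hb⟩ := hR k hk
    obtain ⟨k'', h1, h2⟩ : ∃ k'', bb k'' = bb k' ∧ st k'' = R b := by
      by_cases hbb : bb k' = b
      · have hm : L % (L + 1) = L := Nat.mod_eq_of_lt (by omega)
        by_cases h0 : bb L = b
        · exact ⟨L, by rw [h0, hbb], by rw [(O.htop L hm).2.1, h0]⟩
        · have hf : bb (L + (L + 1)) = b := by
            rw [O.hflip]; revert h0; cases b <;> cases bb L <;> simp
          exact ⟨L + (L + 1), by rw [hf, hbb], by rw [(O.htop _ (by simp)).2.1, hf]⟩
      · have hbb' : bb k' = !b := by revert hbb; cases b <;> cases bb k' <;> simp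
        by_cases h0 : bb 0 = !b
        · exact ⟨0, by rw [h0, hbb'], by rw [O.hbot 0 (by simp), h0, Bool.not_not]⟩
        · have hf : bb (0 + (L + 1)) = !b := by
            rw [O.hflip]; revert h0; cases b <;> cases bb 0 <;> simp
          exact ⟨0 + (L + 1), by rw [hf, hbb'], by rw [O.hbot _ (by simp), hf, Bool.not_not]⟩
    refine ⟨k'', by simp only [CC, h1], fun v hv => ?_⟩
    rw [← hb] at h2
    rcases v with _ | i | j
    · exact absurd rfl hv
    · simp only [CC, h2]
    · simp only [CC, h2]
  · refine ⟨some (Sum.inl ⟨0, by omega⟩), by simp, fun k _ h => ?_⟩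
    simp only [CC, Option.some.injEq] at h
    have := hblinj _ _ h
    rw [O.hflip] at this
    cases hh : bb k <;> simp [hh] at this

end build

end S2S

namespace S2S

theorem clen_congr (T a T' a' : ℕ → ℕ) (m : ℕ) (em : Bool)
    (h : ∀ j, j < m → T j = T' j ∧ a j = a' j) : clen T a m em = clen T' a' m em := by
  induction m generalizing em with
  | zero => rfl
  | succ m ih =>
    rw [clen, clen, ih _ (fun j hj => h j (by omega)), (h m (by omega)).1, (h m (by omega)).2]

theorem half_real (K c : ℕ) (hc : 1 ≤ c) (hK : 2 * c + 1 ≤ K) (m h : ℕ) (h1 : 1 ≤ h)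
    (h2 : h ≤ c ^ m * K) :
    ∃ T a : ℕ → ℕ, (∀ j, a j ≤ T j) ∧ a 0 = 0 ∧ (∀ j, T j < K) ∧ 1 + clen T a (m + 1) true = 2 * h := by
  induction m generalizing h with
  | zero =>
    refine ⟨fun _ => h - 1, fun _ => 0, by simp, rfl, fun _ => by simp at h2 ⊢; omega, ?_⟩
    simp [clen]; omega
  | succ m ih =>
    by_cases hh : h ≤ K
    · refine ⟨fun _ => h - 1, fun _ => 0, by simp, rfl, fun _ => by dsimp only; omega, ?_⟩
      simp [clen]; omega
    · push Not at hh
      obtain ⟨T, a, e1, e2, e3, e4⟩ := ih ((h - 1 - c) / c)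
        ((Nat.one_le_div_iff (by omega)).2 (by omega))
        (by
          apply Nat.div_le_of_le_mul
          rw [← mul_assoc, ← pow_succ']
          omega)
      have hmod := Nat.mod_lt (h - 1 - c) (show 0 < c by omega)
      have hdm := Nat.div_add_mod (h - 1 - c) c
      refine ⟨Function.update T (m + 1) (c + (h - 1 - c) % c), Function.update a (m + 1) c,
        ?_, ?_, ?_, ?_⟩
      · intro j
        by_cases hj : j = m + 1
        · subst hj; simp
        · simpa [hj] using e1 j
      · simpa using e2
      · intro j
        by_cases hj : j = m + 1
        · subst hj; simp; omega
        · simpa [hj] using e3 j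
      · rw [clen, clen_congr _ _ T a (m + 1) true (fun j hj => by
          rw [Function.update_of_ne (by omega), Function.update_of_ne (by omega)]; exact ⟨rfl, rfl⟩), e4]
        simp only [Function.update_self, Bool.toNat_true]
        have : c * (2 * ((h - 1 - c) / c)) = 2 * (c * ((h - 1 - c) / c)) := by ring
        rw [this]
        omega

theorem len_real (K c : ℕ) (hc : 1 ≤ c) (hK : 2 * c + 1 ≤ K) (m L : ℕ) (hL : 2 ≤ L)
    (h2 : L / 2 + 1 ≤ c ^ m * K) :
    ∃ (T a : ℕ → ℕ) (em : Bool), (∀ j, a j ≤ T j) ∧ a 0 = 0 ∧ (∀ j, T j < K) ∧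
      L = clen T a (m + 1) em := by
  rcases Nat.mod_two_eq_zero_or_one L with h | h
  · obtain ⟨T, a, e1, e2, e3, e4⟩ := half_real K c hc hK m (L / 2 + 1) (by omega) h2
    refine ⟨T, a, false, e1, e2, e3, ?_⟩
    rw [clen] at e4 ⊢
    simp at e4 ⊢
    omega
  · obtain ⟨T, a, e1, e2, e3, e4⟩ := half_real K c hc hK m ((L + 1) / 2) (by omega) (by omega)
    refine ⟨T, a, true, e1, e2, e3, ?_⟩
    omega

theorem num_ineq (m : ℕ) (hm : 1 ≤ m) : 8 ^ m * (2 ^ (m + 1) + 1) ≤ 3 ^ m * 2 ^ ((m + 1) * (m + 1)) := by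
  induction m, hm using Nat.le_induction with
  | base => norm_num
  | succ m hm ih =>
    have e1 : 2 ^ ((m + 1 + 1) * (m + 1 + 1)) = 2 ^ ((m + 1) * (m + 1)) * (2 ^ (2 * m + 3)) := by
      rw [← pow_add]; congr 1; ring
    have e2 : 2 ^ 5 ≤ 2 ^ (2 * m + 3) := Nat.pow_le_pow_right (by norm_num) (by omega)
    calc 8 ^ (m + 1) * (2 ^ (m + 1 + 1) + 1) ≤ 16 * (8 ^ m * (2 ^ (m + 1) + 1)) := by
          rw [pow_succ 8 m, pow_succ 2 (m + 1)]
          nlinarith [pow_pos (show 0 < 8 by norm_num) m]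
      _ ≤ 16 * (3 ^ m * 2 ^ ((m + 1) * (m + 1))) := Nat.mul_le_mul_left _ ih
      _ ≤ 3 ^ (m + 1) * 2 ^ ((m + 1 + 1) * (m + 1 + 1)) := by
          rw [e1, pow_succ 3 m]
          calc 16 * (3 ^ m * 2 ^ ((m + 1) * (m + 1))) ≤ (3 * 2 ^ 5) * (3 ^ m * 2 ^ ((m + 1) * (m + 1))) :=
                Nat.mul_le_mul_right _ (by norm_num)
            _ ≤ (3 * 2 ^ (2 * m + 3)) * (3 ^ m * 2 ^ ((m + 1) * (m + 1))) :=
                Nat.mul_le_mul_right _ (by omega)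
            _ = _ := by ring

theorem cap_ineq (q m : ℕ) (hq : 2 ≤ q) (hm : 1 ≤ m) :
    q ^ ((m + 1) * m) * 2 ^ (m + 1) + 1 ≤ ((q ^ (2 * m + 1) - 1) / 2) ^ m * q ^ (2 * m + 1) := by
  set K := q ^ (2 * m + 1) with hK
  set c := (K - 1) / 2 with hc
  have hK8 : 8 ≤ K := by
    calc 8 = 2 ^ 3 := by norm_num
      _ ≤ 2 ^ (2 * m + 1) := Nat.pow_le_pow_right (by norm_num) (by omega)
      _ ≤ K := Nat.pow_le_pow_left hq _
  have h8 : 3 * K ≤ 8 * c := by omega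
  have hpos : 1 ≤ q ^ ((m + 1) * m) := Nat.one_le_pow _ _ (by omega)
  have hKm : K ^ (m + 1) = q ^ ((m + 1) * m) * q ^ ((m + 1) * (m + 1)) := by
    rw [hK, ← pow_mul, ← pow_add]; congr 1; ring
  refine Nat.le_of_mul_le_mul_left ?_ (pow_pos (show 0 < 8 by norm_num) m)
  calc 8 ^ m * (q ^ ((m + 1) * m) * 2 ^ (m + 1) + 1)
      ≤ 8 ^ m * (q ^ ((m + 1) * m) * (2 ^ (m + 1) + 1)) := by
        apply Nat.mul_le_mul_left
        rw [mul_add, mul_one]; omega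
    _ = q ^ ((m + 1) * m) * (8 ^ m * (2 ^ (m + 1) + 1)) := by ring
    _ ≤ q ^ ((m + 1) * m) * (3 ^ m * 2 ^ ((m + 1) * (m + 1))) :=
        Nat.mul_le_mul_left _ (num_ineq m hm)
    _ ≤ q ^ ((m + 1) * m) * (3 ^ m * q ^ ((m + 1) * (m + 1))) := by
        apply Nat.mul_le_mul_left
        apply Nat.mul_le_mul_left
        exact Nat.pow_le_pow_left hq _
    _ = (3 * K) ^ m * K := by
        rw [mul_pow, mul_assoc, ← pow_succ, hKm]; ring
    _ ≤ (8 * c) ^ m * K := Nat.mul_le_mul_right _ (Nat.pow_le_pow_left h8 m)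
    _ = 8 ^ m * (c ^ m * K) := by rw [mul_pow]; ring

theorem card_Kn (n : ℕ) : (Kn (n + 1)).card = (n + 1) * n := by
  have : Kn (n + 1) = (Finset.univ : Finset (Fin (n + 1))).offDiag := by
    ext p; simp [Kn]
  rw [this, Finset.offDiag_card, Finset.card_univ, Fintype.card_fin]
  rw [Nat.mul_succ, Nat.add_sub_cancel]

/-- a stateless protocol with any prescribed threshold -/
theorem threshold_protocol (Λ : Type) [Fintype Λ] [Nonempty Λ] (m L : ℕ) (hm : 1 ≤ m)
    (hq : 2 ≤ Fintype.card Λ) (hL : 3 ≤ L)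
    (hcap : L / 2 ≤ Fintype.card Λ ^ ((m + 1) * m) * 2 ^ (m + 1)) :
    ∃ B : StatelessProtocol (3 * (m + 1)) (Kn (3 * (m + 1))) (Option Λ),
      B.LabelRStabilizing (L - 2) ∧ ¬ B.LabelRStabilizing (L - 1) := by
  obtain ⟨g, hg1, hg2⟩ := gray Λ (2 * m + 1)
  have hc := cap_ineq (Fintype.card Λ) m hq hm
  set K := Fintype.card Λ ^ (2 * m + 1) with hK
  have hK8 : 8 ≤ K := by
    calc 8 = 2 ^ 3 := by norm_num
      _ ≤ 2 ^ (2 * m + 1) := Nat.pow_le_pow_right (by norm_num) (by omega)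
      _ ≤ K := Nat.pow_le_pow_left hq _
  obtain ⟨T, a, em, e1, e2, e3, e4⟩ := len_real K ((K - 1) / 2) (by omega) (by omega) m L (by omega)
    (by omega)
  obtain ⟨st, bb, R, O⟩ := orb_exists T a e1 e2 m em L e4 (by omega)
  obtain ⟨b0, b1, hb⟩ := Fintype.exists_pair_of_one_lt_card (α := Λ) (by omega)
  have H := build (fun b => if b then b0 else b1) g (by simpa using hb) O hL (by omega) e3 hg1 hg2
  have hcard : Fintype.card (Option (Fin (m + 1) ⊕ Fin (2 * m + 1))) = 3 * (m + 1) := by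
    simp; omega
  refine ⟨wrap (Fintype.equivFinOfCardEq hcard) (gact none _ L), ?_, gen_not_stab _ H⟩
  exact wrap_stab _ _ _ (fun σ M0 hf => gen_stab H σ M0 hf)

theorem sub_stab {n : ℕ} {E : Finset (Fin n × Fin n)} {Λ : Type} (P : StatefulProtocol n E Λ)
    (h : Subsingleton ({e // e ∈ E} → Λ)) (r : ℕ) : P.LabelRStabilizing r :=
  fun _ _ _ _ _ => ⟨0, fun _ _ => Subsingleton.elim _ _⟩

end S2S

/-- For every stateful protocol `A` on the complete graph
`K_n` there is a stateless protocol on `K_{3n}` over the label space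
`Σ ∪ {ω}` (modeled as `Option Λ`, with `none` the fresh label `ω`) that is
label `r`-stabilizing if and only if `A` is, for every `r ≥ 1`. -/
theorem stateful_to_stateless (n : ℕ) {Λ : Type} [Fintype Λ] [Nonempty Λ]
    (A : StatefulProtocol n (Kn n) Λ) :
    ∃ B : StatelessProtocol (3 * n) (Kn (3 * n)) (Option Λ),
      ∀ r : ℕ, 1 ≤ r → (A.LabelRStabilizing r ↔ B.LabelRStabilizing r) := by
  classical
  by_cases hall : ∀ r, 1 ≤ r → A.LabelRStabilizing r
  · refine ⟨S2S.wrap (Equiv.refl (Fin (3 * n))) (fun _ _ _ => none), fun r hr => ?_⟩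
    exact ⟨fun _ => S2S.wrap_stab _ _ _ (fun σ M0 hf => S2S.const_stab r σ M0 hf),
      fun _ => hall r hr⟩
  · push Not at hall
    have hsub : ¬ Subsingleton ({e // e ∈ Kn n} → Λ) := by
      intro h
      obtain ⟨r, _, h2⟩ := hall
      exact h2 (S2S.sub_stab A h r)
    have hn : 2 ≤ n := by
      by_contra hc
      apply hsub
      refine ⟨fun f f' => ?_⟩
      funext e
      obtain ⟨⟨i, j⟩, he⟩ := e
      have h1 : i ≠ j := by simpa [Kn] using he
      exact absurd (Fin.ext (by omega)) h1
    have hq : 2 ≤ Fintype.card Λ := by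
      by_contra hc
      have : Subsingleton Λ := Fintype.card_le_one_iff_subsingleton.1 (by omega)
      exact hsub inferInstance
    set r0 := Nat.find hall with hr0
    have hr1 : 1 ≤ r0 := (Nat.find_spec hall).1
    have hr2 : ¬ A.LabelRStabilizing r0 := (Nat.find_spec hall).2
    have hmin : ∀ r, 1 ≤ r → r < r0 → A.LabelRStabilizing r := by
      intro r h1 h2
      by_contra hc
      exact Nat.find_min hall h2 ⟨h1, hc⟩
    have hA : ∀ r, 1 ≤ r → (A.LabelRStabilizing r ↔ r < r0) := by
      intro r h1
      refine ⟨fun h => ?_, hmin r h1⟩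
      by_contra hc
      exact hr2 (S2S.stabA_anti A (by omega) h)
    by_cases h1 : r0 = 1
    · obtain ⟨l⟩ := ‹Nonempty Λ›
      refine ⟨S2S.wrap (Equiv.refl (Fin (3 * n)))
        (S2S.togg l ⟨0, by omega⟩ ⟨1, by omega⟩), fun r hr => ?_⟩
      rw [hA r hr]
      refine ⟨fun h => by omega, fun h => ?_⟩
      exfalso
      refine S2S.wrap_not_stab _ _ r (fun _ => Finset.univ) (fun _ _ => none)
        (fun _ => ⟨⟨0, by omega⟩, Finset.mem_univ _⟩) (fun i t => ⟨t, le_rfl, by omega, Finset.mem_univ _⟩)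
        (fun T => ⟨T + 1, by omega, ⟨0, by omega⟩, ⟨1, by omega⟩, fun e => by simpa using congrArg Fin.val e, ?_⟩) h
      rw [S2S.togg_run l _ _ (by simp), S2S.togg_run l _ _ (by simp)]
      rcases Nat.mod_two_eq_zero_or_one T with h0 | h0
      · have : (T + 1) % 2 = 1 := by omega
        simp [h0, this]
      · have : (T + 1) % 2 = 0 := by omega
        simp [h0, this]
    · obtain ⟨m, rfl⟩ : ∃ m, n = m + 1 := ⟨n - 1, by omega⟩
      have hb := S2S.loop_bound A r0 hr2
      have hle : r0 ≤ Fintype.card Λ ^ ((m + 1) * m) * (2 ^ (m + 1) * 2) := by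
        have hcard : Fintype.card ({e // e ∈ Kn (m + 1)} → Λ) = Fintype.card Λ ^ ((m + 1) * m) := by
          rw [Fintype.card_fun, Fintype.card_coe, S2S.card_Kn]
        rw [hcard] at hb
        by_contra hc
        refine hb (hmin _ ?_ (by omega))
        exact Nat.mul_pos (pow_pos (by omega) _) (by positivity)
      rw [← mul_assoc] at hle
      obtain ⟨B, hB1, hB2⟩ := S2S.threshold_protocol Λ m (r0 + 1) (by omega) hq (by omega) (by omega)
      refine ⟨B, fun r hr => ?_⟩
      rw [hA r hr]
      refine ⟨fun h => S2S.stabB_anti B (by omega) hB1, fun h => ?_⟩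
      by_contra hc
      exact hB2 (S2S.stabB_anti B (by omega) h)
end
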